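/- arXiv:nlin/0302026 — 5 statements merged into one kernel-verified Lean document; each statement's English description precedes it below -/
import Mathlib

section
/- With the family (φ_μ) and the Hankel determinants τ_n^{μ} as in the context, for every integer n ≥ 0, on every open interval on which none of the τ-functions appearing in the denominators vanishes, the pair q = (d/dt) log(τ_{n+1}^{ν}/τ_n^{ν}) − t and p = τ_{n+1}^{ν}τ_{n−1}^{ν−1}/(τ_n^{ν−1}τ_n^{ν}) gives a solution of the Hamiltonian system S_IV with parameters κ₀ = ν+1 and θ∞ = n. -/
open Polynomial in
/-- The linear functional on polynomials sending `X ^ k` to `a k`. -/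
noncomputable def momentFunctional {K : Type*} [Field K] (a : ℕ → K) : K[X] →ₗ[K] K :=
  lsum fun k => a k • LinearMap.id

/-- The Hankel matrix of size `n` of the sequence `a`. -/
def hankel {K : Type*} (a : ℕ → K) (n : ℕ) : Matrix (Fin n) (Fin n) K :=
  Matrix.of fun i j => a (i + j)

theorem hankel_transpose {K : Type*} (a : ℕ → K) (n : ℕ) :
    (hankel a n).transpose = hankel a n := by
  ext i j
  simp [hankel, add_comm]

open Polynomial in
/-- The orthogonal polynomial of degree `n` of the moment sequence `a`, normalised to have
leading coefficient `det (hankel a n)`. -/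
noncomputable def orthPoly {K : Type*} [Field K] (a : ℕ → K) (n : ℕ) : K[X] :=
  ∑ k : Fin (n + 1), monomial (k : ℕ) ((hankel a (n + 1)).adjugate k (Fin.last n))

section Algebra

open Polynomial

variable {K : Type*} [Field K] (a : ℕ → K)

theorem momentFunctional_monomial (k : ℕ) (c : K) :
    momentFunctional a (monomial k c) = a k * c := by
  simp [momentFunctional, lsum_apply]

theorem momentFunctional_mul_X_pow {f : K[X]} {N : ℕ} (hf : f.natDegree < N) (i : ℕ) :
    momentFunctional a (f * X ^ i) = ∑ k ∈ Finset.range N, f.coeff k * a (k + i) := by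
  conv_lhs => rw [f.as_sum_range' N hf]
  rw [Finset.sum_mul, map_sum]
  refine Finset.sum_congr rfl fun k _ => ?_
  rw [monomial_mul_X_pow, momentFunctional_monomial, mul_comm]

theorem coeff_orthPoly (n : ℕ) (k : Fin (n + 1)) :
    (orthPoly a n).coeff k = (hankel a (n + 1)).adjugate k (Fin.last n) := by
  simp [orthPoly, finsetSum_coeff, coeff_monomial, Fin.val_inj]

theorem natDegree_orthPoly_lt (n : ℕ) : (orthPoly a n).natDegree < n + 1 := by
  refine Nat.lt_succ_of_le (natDegree_sum_le_of_forall_le _ _ fun k _ => ?_)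
  exact (natDegree_monomial_le _).trans (Nat.le_of_lt_succ k.2)

theorem coeff_orthPoly_of_lt {n k : ℕ} (h : n < k) : (orthPoly a n).coeff k = 0 :=
  coeff_eq_zero_of_natDegree_lt (by have := natDegree_orthPoly_lt a n; omega)

theorem coeff_orthPoly_self (n : ℕ) : (orthPoly a n).coeff n = (hankel a n).det := by
  have h := coeff_orthPoly a n (Fin.last n)
  rw [Fin.val_last] at h
  rw [h, Matrix.adjugate_fin_succ_eq_det_submatrix, ← two_mul, pow_mul, neg_one_sq, one_pow,
    one_mul]
  congr 1
  ext i j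
  simp [hankel]

theorem coeff_zero_orthPoly (n : ℕ) :
    (orthPoly a n).coeff 0 = (-1) ^ n * (hankel (fun k => a (k + 1)) n).det := by
  have h := coeff_orthPoly a n 0
  rw [Fin.val_zero] at h
  rw [h, Matrix.adjugate_fin_succ_eq_det_submatrix]
  simp only [Fin.val_last, Fin.val_zero, add_zero]
  congr 2
  ext i j
  simp [hankel, add_assoc]

theorem momentFunctional_orthPoly (n i : ℕ) :
    momentFunctional a (orthPoly a n * X ^ i) =
      ∑ k : Fin (n + 1), (hankel a (n + 1)).adjugate k (Fin.last n) * a (k + i) := by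
  rw [momentFunctional_mul_X_pow a (natDegree_orthPoly_lt a n), Finset.sum_range]
  simp only [coeff_orthPoly]

theorem momentFunctional_orthPoly_fin (n : ℕ) (i : Fin (n + 1)) :
    momentFunctional a (orthPoly a n * X ^ (i : ℕ)) =
      if i = Fin.last n then (hankel a (n + 1)).det else 0 := by
  have h := congrFun (congrFun (Matrix.mul_adjugate (hankel a (n + 1))) i) (Fin.last n)
  rw [Matrix.mul_apply, Matrix.smul_apply, Matrix.one_apply, smul_eq_mul, mul_ite, mul_one,
    mul_zero] at h
  rw [momentFunctional_orthPoly, ← h]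
  refine Finset.sum_congr rfl fun k _ => ?_
  simp [hankel, mul_comm, add_comm]

theorem momentFunctional_orthPoly_of_lt {n i : ℕ} (h : i < n) :
    momentFunctional a (orthPoly a n * X ^ i) = 0 := by
  have := momentFunctional_orthPoly_fin a n ⟨i, by omega⟩
  rwa [if_neg (by simp [Fin.ext_iff]; omega)] at this

theorem momentFunctional_orthPoly_self (n : ℕ) :
    momentFunctional a (orthPoly a n * X ^ n) = (hankel a (n + 1)).det := by
  simpa using momentFunctional_orthPoly_fin a n (Fin.last n)

variable {a}

/-- A nonzero Hankel determinant makes the moment pairing nondegenerate in low degree. -/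
theorem eq_zero_of_momentFunctional {n : ℕ} (hn : (hankel a n).det ≠ 0) {f : K[X]}
    (hf : ∀ k, n ≤ k → f.coeff k = 0)
    (h : ∀ i < n, momentFunctional a (f * X ^ i) = 0) : f = 0 := by
  obtain rfl | hpos := Nat.eq_zero_or_pos n
  · ext k
    exact hf k (Nat.zero_le _)
  have hdeg : f.natDegree < n :=
    (natDegree_le_iff_coeff_eq_zero (n := n - 1).2 fun k hk => hf k (by omega)).trans_lt (by omega)
  have hv : (fun k : Fin n => f.coeff k) = 0 := by
    refine Matrix.eq_zero_of_mulVec_eq_zero hn ?_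
    ext i
    have hi := h i i.2
    rw [momentFunctional_mul_X_pow a hdeg, Finset.sum_range] at hi
    rw [Pi.zero_apply, ← hi, Matrix.mulVec, dotProduct]
    refine Finset.sum_congr rfl fun k _ => ?_
    simp [hankel, mul_comm, add_comm]
  ext k
  by_cases hk : k < n
  · exact congrFun hv ⟨k, hk⟩
  · exact hf k (by omega)

/-- Orthogonality extended to all polynomials of low degree. -/
theorem momentFunctional_orthPoly_mul {n : ℕ} {f : K[X]} (hf : f.natDegree < n + 1) :
    momentFunctional a (orthPoly a n * f) = f.coeff n * (hankel a (n + 1)).det := by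
  conv_lhs => rw [f.as_sum_range' (n + 1) hf]
  rw [Finset.mul_sum, map_sum, Finset.sum_range_succ, Finset.sum_eq_zero, zero_add]
  · rw [← C_mul_X_pow_eq_monomial, mul_left_comm, ← smul_eq_C_mul, map_smul,
      momentFunctional_orthPoly_self, smul_eq_mul]
  · intro k hk
    rw [← C_mul_X_pow_eq_monomial, mul_left_comm, ← smul_eq_C_mul, map_smul,
      momentFunctional_orthPoly_of_lt a (Finset.mem_range.1 hk), smul_zero]

theorem coeff_orthPoly_sub_one {m : ℕ} (h : (hankel a (m + 1)).det ≠ 0) :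
    (orthPoly a (m + 1)).coeff m = -momentFunctional a (orthPoly a m * X ^ (m + 1)) := by
  have h1 : momentFunctional a (orthPoly a (m + 1) * orthPoly a m) = 0 := by
    rw [momentFunctional_orthPoly_mul (by have := natDegree_orthPoly_lt a m; omega),
      coeff_orthPoly_of_lt a (Nat.lt_succ_self m), zero_mul]
  rw [mul_comm, (orthPoly a (m + 1)).as_sum_range' (m + 2) (natDegree_orthPoly_lt a _),
    Finset.mul_sum, map_sum, Finset.sum_range_succ, Finset.sum_range_succ,
    Finset.sum_eq_zero, zero_add] at h1
  · simp only [← C_mul_X_pow_eq_monomial, ← smul_eq_C_mul, mul_smul_comm, map_smul,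
      momentFunctional_orthPoly_self, smul_eq_mul, coeff_orthPoly_self] at h1
    refine mul_left_cancel₀ h ?_
    linear_combination h1
  · intro k hk
    rw [← C_mul_X_pow_eq_monomial, mul_left_comm, ← smul_eq_C_mul, map_smul,
      momentFunctional_orthPoly_of_lt a (Finset.mem_range.1 hk), smul_zero]


theorem momentFunctional_C_mul (c : K) (f : K[X]) :
    momentFunctional a (C c * f) = c * momentFunctional a f := by
  rw [← smul_eq_C_mul, map_smul, smul_eq_mul]

/-- The Pearson equation for moments satisfying a three-term recurrence. -/
theorem momentFunctional_pearson {ν t : K}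
    (ha : ∀ k : ℕ, a (k + 2) = t * a (k + 1) - (ν - k) * a k) (f : K[X]) :
    momentFunctional a (X * derivative f) + t * momentFunctional a (X * f)
      - momentFunctional a (X ^ 2 * f) - ν * momentFunctional a f = 0 := by
  induction f using Polynomial.induction_on' with
  | add f g hf hg =>
    simp only [mul_add, map_add]
    linear_combination hf + hg
  | monomial k c =>
    have h0 : X * derivative (monomial k c) = monomial k (c * k) := by
      rcases k with _ | k
      · simp
      · rw [derivative_monomial, X_mul_monomial, Nat.add_sub_cancel]
    rw [h0, X_mul_monomial, X_pow_mul_monomial]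
    simp only [momentFunctional_monomial, ha]
    ring

theorem momentFunctional_X_mul_derivative_orthPoly {ν t : K}
    (ha : ∀ k : ℕ, a (k + 2) = t * a (k + 1) - (ν - k) * a k) {n i : ℕ} (hi : i < n) :
    momentFunctional a (X * derivative (orthPoly a n) * X ^ i) =
      momentFunctional a (orthPoly a n * X ^ (i + 2))
        - t * momentFunctional a (orthPoly a n * X ^ (i + 1)) := by
  have h := momentFunctional_pearson ha (orthPoly a n * X ^ i)
  have h1 : X * derivative (orthPoly a n * X ^ i) =
      X * derivative (orthPoly a n) * X ^ i + C (i : K) * (orthPoly a n * X ^ i) := by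
    rw [derivative_mul, derivative_X_pow]
    rcases i with _ | i
    · simp
    · rw [Nat.add_sub_cancel]; ring
  have h2 : X * (orthPoly a n * X ^ i) = orthPoly a n * X ^ (i + 1) := by ring
  have h3 : X ^ 2 * (orthPoly a n * X ^ i) = orthPoly a n * X ^ (i + 2) := by ring
  rw [h1, h2, h3, map_add, momentFunctional_C_mul, momentFunctional_orthPoly_of_lt a hi] at h
  linear_combination h

variable {m : ℕ}

/-- The differential-difference relation for the orthogonal polynomials of a semiclassical
functional. -/
theorem orthPoly_structure_relation {ν t : K}
    (ha : ∀ k : ℕ, a (k + 2) = t * a (k + 1) - (ν - k) * a k)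
    (h1 : (hankel a (m + 1)).det ≠ 0) :
    C ((hankel a (m + 1)).det ^ 2) * (X * derivative (orthPoly a (m + 1))) =
      C ((m + 1) * (hankel a (m + 1)).det ^ 2 - (hankel a (m + 2)).det * (hankel a m).det)
          * orthPoly a (m + 1)
        + C ((hankel a (m + 1)).det * (hankel a (m + 2)).det) * (X * orthPoly a m)
        + C ((hankel a (m + 1)).det * momentFunctional a (orthPoly a (m + 1) * X ^ (m + 2))
            - (hankel a (m + 2)).det * momentFunctional a (orthPoly a m * X ^ (m + 1))
            - t * ((hankel a (m + 1)).det * (hankel a (m + 2)).det)) * orthPoly a m := by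
  rw [← sub_eq_zero]
  refine eq_zero_of_momentFunctional h1 (fun k hk => ?_) fun i hi => ?_
  · obtain ⟨k, rfl⟩ : ∃ j, k = j + 1 := ⟨k - 1, by omega⟩
    simp only [coeff_sub, coeff_add, coeff_C_mul, coeff_X_mul, coeff_derivative]
    obtain hk' | hk' : k = m ∨ m < k := by omega
    · subst hk'
      rw [coeff_orthPoly_self, coeff_orthPoly_self, coeff_orthPoly_of_lt a (Nat.lt_succ_self _)]
      ring
    · rw [coeff_orthPoly_of_lt a (by omega : m + 1 < k + 1), coeff_orthPoly_of_lt a hk',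
        coeff_orthPoly_of_lt a (by omega : m < k + 1)]
      ring
  · have e : X * orthPoly a m * X ^ i = orthPoly a m * X ^ (i + 1) := by ring
    simp only [sub_mul, add_mul, map_sub, map_add, mul_assoc (C _), momentFunctional_C_mul, e,
      momentFunctional_X_mul_derivative_orthPoly ha hi, momentFunctional_orthPoly_of_lt a hi]
    obtain hi' | hi' | hi' : i = m ∨ i + 1 = m ∨ i + 1 < m := by omega
    · subst hi'
      rw [momentFunctional_orthPoly_self, momentFunctional_orthPoly_self]
      ring
    · subst hi'
      rw [momentFunctional_orthPoly_self, momentFunctional_orthPoly_self,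
        momentFunctional_orthPoly_of_lt a (by omega : i + 1 < i + 1 + 1),
        momentFunctional_orthPoly_of_lt a (Nat.lt_succ_self i)]
      ring
    · rw [momentFunctional_orthPoly_of_lt a (by omega : i + 2 < m + 1),
        momentFunctional_orthPoly_of_lt a (by omega : i + 1 < m + 1),
        momentFunctional_orthPoly_of_lt a hi', momentFunctional_orthPoly_of_lt a (by omega : i < m)]
      ring

theorem orthPoly_three_term (h1 : (hankel a (m + 1)).det ≠ 0) (h2 : (hankel a (m + 2)).det ≠ 0) :
    C ((hankel a (m + 1)).det * (hankel a (m + 2)).det) * (X * orthPoly a (m + 1)) =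
      C ((hankel a (m + 1)).det * momentFunctional a (orthPoly a (m + 1) * X ^ (m + 2))
            - (hankel a (m + 2)).det * momentFunctional a (orthPoly a m * X ^ (m + 1)))
          * orthPoly a (m + 1)
        + C ((hankel a (m + 1)).det ^ 2) * orthPoly a (m + 2)
        + C ((hankel a (m + 2)).det ^ 2) * orthPoly a m := by
  rw [← sub_eq_zero]
  refine eq_zero_of_momentFunctional h1 (fun k hk => ?_) fun i hi => ?_
  · obtain ⟨k, rfl⟩ : ∃ j, k = j + 1 := ⟨k - 1, by omega⟩
    simp only [coeff_sub, coeff_add, coeff_C_mul, coeff_X_mul]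
    obtain hk' | hk' | hk' : k = m ∨ k = m + 1 ∨ m + 1 < k := by omega
    · subst hk'
      rw [coeff_orthPoly_self, coeff_orthPoly_sub_one h1, coeff_orthPoly_sub_one h2,
        coeff_orthPoly_of_lt a (Nat.lt_succ_self _)]
      ring
    · subst hk'
      rw [coeff_orthPoly_self, coeff_orthPoly_self, coeff_orthPoly_of_lt a (Nat.lt_succ_self _),
        coeff_orthPoly_of_lt a (by omega)]
      ring
    · rw [coeff_orthPoly_of_lt a hk', coeff_orthPoly_of_lt a (by omega),
        coeff_orthPoly_of_lt a (by omega), coeff_orthPoly_of_lt a (by omega)]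
      ring
  · have e : X * orthPoly a (m + 1) * X ^ i = orthPoly a (m + 1) * X ^ (i + 1) := by ring
    simp only [sub_mul, add_mul, map_sub, map_add, mul_assoc (C _), momentFunctional_C_mul, e,
      momentFunctional_orthPoly_of_lt a hi, momentFunctional_orthPoly_of_lt a (by omega : i < m + 2)]
    obtain hi' | hi' : i = m ∨ i < m := by omega
    · subst hi'
      rw [momentFunctional_orthPoly_self, momentFunctional_orthPoly_self]
      ring
    · rw [momentFunctional_orthPoly_of_lt a (by omega), momentFunctional_orthPoly_of_lt a hi']
      ring

theorem hankel_string_equation_zero {ν t : K}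
    (ha : ∀ k : ℕ, a (k + 2) = t * a (k + 1) - (ν - k) * a k)
    (h1 : (hankel a (m + 1)).det ≠ 0) :
    ((m + 1) * (hankel a (m + 1)).det ^ 2 - (hankel a (m + 2)).det * (hankel a m).det)
        * (hankel (fun k => a (k + 1)) (m + 1)).det =
      ((hankel a (m + 1)).det * momentFunctional a (orthPoly a (m + 1) * X ^ (m + 2))
            - (hankel a (m + 2)).det * momentFunctional a (orthPoly a m * X ^ (m + 1))
            - t * ((hankel a (m + 1)).det * (hankel a (m + 2)).det))
        * (hankel (fun k => a (k + 1)) m).det := by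
  have h := congrArg (fun f => coeff f 0) (orthPoly_structure_relation ha h1)
  simp only [coeff_add, coeff_C_mul, coeff_X_mul_zero, coeff_zero_orthPoly] at h
  refine mul_left_cancel₀ (pow_ne_zero m (neg_ne_zero.2 (one_ne_zero (α := K)))) ?_
  linear_combination h

theorem hankel_string_equation_sum {ν t : K}
    (ha : ∀ k : ℕ, a (k + 2) = t * a (k + 1) - (ν - k) * a k)
    (h1 : (hankel a (m + 1)).det ≠ 0) (h2 : (hankel a (m + 2)).det ≠ 0) {x : K}
    (hx : x = (hankel a (m + 1)).det * momentFunctional a (orthPoly a (m + 1) * X ^ (m + 2))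
            - (hankel a (m + 2)).det * momentFunctional a (orthPoly a m * X ^ (m + 1))) :
    x ^ 2 - t * x * ((hankel a (m + 1)).det * (hankel a (m + 2)).det)
        + (hankel a (m + 2)).det ^ 3 * (hankel a m).det
        + (hankel a (m + 1)).det ^ 3 * (hankel a (m + 3)).det =
      (2 * (m + 1) - ν) * ((hankel a (m + 1)).det * (hankel a (m + 2)).det) ^ 2 := by
  set P := orthPoly a (m + 1) with hP
  have hrec := orthPoly_three_term h1 h2
  rw [← hx, ← hP] at hrec
  have cP : P.coeff (m + 1) = (hankel a (m + 1)).det := coeff_orthPoly_self a (m + 1)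
  have dP : P.natDegree < m + 2 := natDegree_orthPoly_lt a (m + 1)
  have dR : (orthPoly a m).natDegree < m + 1 := natDegree_orthPoly_lt a m
  have dXP : (X * P).natDegree < m + 3 := by
    have := natDegree_mul_le (p := X) (q := P)
    have := natDegree_X_le (R := K)
    omega
  have dXR : (X * orthPoly a m).natDegree < m + 2 := by
    have := natDegree_mul_le (p := X) (q := orthPoly a m)
    have := natDegree_X_le (R := K)
    omega
  have dXP' : (X * derivative P).natDegree < m + 2 := by
    have := natDegree_mul_le (p := X) (q := derivative P)
    have := natDegree_X_le (R := K)
    have := natDegree_derivative_le P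
    omega
  have ePP : momentFunctional a (P * P) = (hankel a (m + 1)).det * (hankel a (m + 2)).det := by
    rw [hP, momentFunctional_orthPoly_mul dP, cP]
  have eQP : momentFunctional a (orthPoly a (m + 2) * P) = 0 := by
    rw [momentFunctional_orthPoly_mul (by omega), coeff_orthPoly_of_lt a (by omega), zero_mul]
  have eRP : momentFunctional a (orthPoly a m * P) = 0 := by
    rw [mul_comm, hP, momentFunctional_orthPoly_mul (by omega), coeff_orthPoly_of_lt a (by omega),
      zero_mul]
  have eQXP : momentFunctional a (orthPoly a (m + 2) * (X * P)) =
      (hankel a (m + 1)).det * (hankel a (m + 3)).det := by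
    rw [momentFunctional_orthPoly_mul dXP, coeff_X_mul, cP]
  have eRXP : momentFunctional a (orthPoly a m * (X * P)) =
      (hankel a m).det * (hankel a (m + 2)).det := by
    rw [show orthPoly a m * (X * P) = P * (X * orthPoly a m) by ring, hP,
      momentFunctional_orthPoly_mul dXR, coeff_X_mul, coeff_orthPoly_self]
  have ePXP' : momentFunctional a (P * (X * derivative P)) =
      (m + 1) * (hankel a (m + 1)).det * (hankel a (m + 2)).det := by
    rw [hP, momentFunctional_orthPoly_mul dXP', coeff_X_mul, coeff_derivative, cP]
    ring
  have hXPP : momentFunctional a (X * (P * P)) = x := by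
    have h := congrArg (fun f => momentFunctional a (f * P)) hrec
    simp only [add_mul, map_add, mul_assoc (C _), momentFunctional_C_mul, mul_assoc X,
      ePP, eQP, eRP] at h
    refine mul_left_cancel₀ (mul_ne_zero h1 h2) ?_
    linear_combination h
  have hXXPP : (hankel a (m + 1)).det * (hankel a (m + 2)).det *
      momentFunctional a (X ^ 2 * (P * P)) = x ^ 2
        + (hankel a (m + 1)).det ^ 3 * (hankel a (m + 3)).det
        + (hankel a (m + 2)).det ^ 3 * (hankel a m).det := by
    have h := congrArg (fun f => momentFunctional a (f * (X * P))) hrec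
    simp only [add_mul, map_add, mul_assoc (C _), momentFunctional_C_mul, eQXP, eRXP] at h
    rw [show X * P * (X * P) = X ^ 2 * (P * P) by ring,
      show P * (X * P) = X * (P * P) by ring, hXPP] at h
    linear_combination h
  have hpear := momentFunctional_pearson ha (P * P)
  rw [derivative_mul, show X * (derivative P * P + P * derivative P) =
    P * (X * derivative P) + P * (X * derivative P) by ring, map_add, ePXP', hXPP, ePP] at hpear
  linear_combination
    -((hankel a (m + 1)).det * (hankel a (m + 2)).det) * hpear - hXXPP

/-- The evolution of the orthogonal polynomials under the Toda flow. -/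
theorem toda_flow_orthPoly (h1 : (hankel a (m + 1)).det ≠ 0) {f : K[X]} {d : K}
    (hf : ∀ k, m + 1 < k → f.coeff k = 0) (hd : f.coeff (m + 1) = d)
    (h : ∀ i < m + 1, momentFunctional a (f * X ^ i)
      + momentFunctional a (orthPoly a (m + 1) * X ^ (i + 1)) = 0) :
    C (hankel a (m + 1)).det * f - C d * orthPoly a (m + 1) =
      -(C (hankel a (m + 2)).det * orthPoly a m) := by
  rw [← sub_eq_zero]
  refine eq_zero_of_momentFunctional h1 (fun k hk => ?_) fun i hi => ?_
  · simp only [coeff_sub, coeff_neg, coeff_C_mul]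
    rw [coeff_orthPoly_of_lt a (by omega : m < k)]
    obtain rfl | hk' : k = m + 1 ∨ m + 1 < k := by omega
    · rw [hd, coeff_orthPoly_self]
      ring
    · rw [hf k hk', coeff_orthPoly_of_lt a hk']
      ring
  · simp only [sub_mul, neg_mul, map_sub, map_neg, mul_assoc (C _), momentFunctional_C_mul,
      eq_neg_of_add_eq_zero_left (h i hi), momentFunctional_orthPoly_of_lt a hi]
    obtain rfl | hi' : i = m ∨ i < m := by omega
    · rw [momentFunctional_orthPoly_self, momentFunctional_orthPoly_self]
      ring
    · rw [momentFunctional_orthPoly_of_lt a hi', momentFunctional_orthPoly_of_lt a (by omega)]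
      ring

theorem toda_flow_orthPoly_pred (h1 : (hankel a (m + 1)).det ≠ 0) {f : K[X]} {d : K}
    (hf : ∀ k, m < k → f.coeff k = 0)
    (hd : momentFunctional a (orthPoly a m * X ^ (m + 1)) = d)
    (h : ∀ i < m + 1, momentFunctional a (f * X ^ i)
      + momentFunctional a (orthPoly a m * X ^ (i + 1)) = if i = m then d else 0) :
    C d * orthPoly a m - C (hankel a (m + 1)).det * f =
      C (hankel a (m + 1)).det * (X * orthPoly a m)
        - C (hankel a m).det * orthPoly a (m + 1) := by
  rw [← sub_eq_zero]
  refine eq_zero_of_momentFunctional h1 (fun k hk => ?_) fun i hi => ?_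
  · obtain ⟨k, rfl⟩ : ∃ j, k = j + 1 := ⟨k - 1, by omega⟩
    simp only [coeff_sub, coeff_C_mul, coeff_X_mul]
    rw [hf _ (by omega), coeff_orthPoly_of_lt a (by omega : m < k + 1)]
    obtain rfl | hk' : k = m ∨ m < k := by omega
    · rw [coeff_orthPoly_self, coeff_orthPoly_self]
      ring
    · rw [coeff_orthPoly_of_lt a hk', coeff_orthPoly_of_lt a (by omega : m + 1 < k + 1)]
      ring
  · have e : X * orthPoly a m * X ^ i = orthPoly a m * X ^ (i + 1) := by ring
    have hi2 := eq_sub_of_add_eq (h i hi)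
    simp only [sub_mul, map_sub, mul_assoc (C _), momentFunctional_C_mul, e, hi2,
      momentFunctional_orthPoly_of_lt a hi]
    obtain rfl | hi' : i = m ∨ i < m := by omega
    · rw [momentFunctional_orthPoly_self, hd, if_pos rfl]
      ring
    · rw [momentFunctional_orthPoly_of_lt a hi', if_neg (by omega)]
      ring

end Algebra

/-- Jacobi's formula for the derivative of a determinant. -/
theorem hasDerivAt_det {ι : Type*} [Fintype ι] [DecidableEq ι] {M : ℝ → Matrix ι ι ℂ}
    {M' : Matrix ι ι ℂ} {t : ℝ} (h : ∀ i j, HasDerivAt (fun s => M s i j) (M' i j) t) :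
    HasDerivAt (fun s => (M s).det) (∑ i, ∑ j, (M t).adjugate i j * M' j i) t := by
  have key : ∑ i, ∑ j, (M t).adjugate i j * M' j i =
      ∑ σ : Equiv.Perm ι, ((Equiv.Perm.sign σ : ℤ) : ℂ) *
        ∑ i, (∏ j ∈ Finset.univ.erase i, M t (σ j) j) • M' (σ i) i := by
    simp only [Finset.mul_sum]
    conv_rhs => rw [Finset.sum_comm]
    refine Finset.sum_congr rfl fun i _ => ?_
    have hc := congrFun (Matrix.cramer_eq_adjugate_mulVec (M t) fun j => M' j i) i
    rw [Matrix.mulVec, dotProduct] at hc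
    rw [← hc, Matrix.cramer_apply, Matrix.det_apply']
    refine Finset.sum_congr rfl fun σ _ => ?_
    rw [← Finset.prod_erase_mul _ _ (Finset.mem_univ i), smul_eq_mul, Matrix.updateCol_self]
    congr 2
    exact Finset.prod_congr rfl fun j hj => Matrix.updateCol_ne (Finset.ne_of_mem_erase hj)
  rw [key]
  simp only [Matrix.det_apply']
  refine HasDerivAt.fun_sum fun σ _ => ?_
  exact (HasDerivAt.fun_finsetProd (f := fun i s => M s (σ i) i) fun i _ => h (σ i) i).const_mul
    ((Equiv.Perm.sign σ : ℤ) : ℂ)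

section TodaFlow

open Polynomial

variable {a : ℕ → ℝ → ℂ}

theorem hasDerivAt_hankel_det (ha : ∀ k t, HasDerivAt (a k) (a (k + 1) t) t) (m : ℕ) (t : ℝ) :
    HasDerivAt (fun s => (hankel (fun k => a k s) (m + 1)).det)
      (momentFunctional (fun k => a k t) (orthPoly (fun k => a k t) m * X ^ (m + 1))) t := by
  have h := hasDerivAt_det (M := fun s => hankel (fun k => a k s) (m + 1))
    (M' := Matrix.of fun i j => a (i + j + 1) t) (t := t) fun i j => ha (i + j) t
  convert h using 1
  rw [Fin.sum_univ_castSucc, Finset.sum_eq_zero, zero_add, momentFunctional_orthPoly]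
  · refine Finset.sum_congr rfl fun j _ => ?_
    congr 1
    rw [← Matrix.transpose_apply (Matrix.adjugate _), Matrix.adjugate_transpose,
      hankel_transpose]
  · intro i _
    have hi := congrFun (congrFun (Matrix.adjugate_mul (hankel (fun k => a k t) (m + 1)))
      i.castSucc) i.succ
    rw [Matrix.mul_apply, Matrix.smul_apply, Matrix.one_apply_ne (Fin.castSucc_lt_succ).ne,
      smul_zero] at hi
    rw [← hi]
    refine Finset.sum_congr rfl fun j _ => ?_
    simp [hankel, add_assoc]

theorem exists_hasDerivAt_orthPoly (ha : ∀ k t, HasDerivAt (a k) (a (k + 1) t) t)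
    (n : ℕ) (t : ℝ) :
    ∃ f : ℂ[X], ∀ k,
      HasDerivAt (fun s => (orthPoly (fun k => a k s) n).coeff k) (f.coeff k) t := by
  have hdiff : ∀ k < n + 1,
      DifferentiableAt ℝ (fun s => (orthPoly (fun k => a k s) n).coeff k) t := by
    intro k hk
    have e := fun s => coeff_orthPoly (fun k => a k s) n ⟨k, hk⟩
    simp only at e
    simp only [e, Matrix.adjugate_fin_succ_eq_det_submatrix]
    refine DifferentiableAt.const_mul (HasDerivAt.differentiableAt (hasDerivAt_det
      (M' := Matrix.of fun i j => a (((Fin.last n).succAbove i : ℕ)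
        + ((⟨k, hk⟩ : Fin (n + 1)).succAbove j : ℕ) + 1) t) fun i j => ?_)) _
    exact ha _ t
  refine ⟨∑ k ∈ Finset.range (n + 1),
    monomial k (deriv (fun s => (orthPoly (fun k => a k s) n).coeff k) t), fun k => ?_⟩
  simp only [finsetSum_coeff, coeff_monomial, Finset.sum_ite_eq', Finset.mem_range]
  split_ifs with hk
  · exact (hdiff k hk).hasDerivAt
  · simp only [coeff_orthPoly_of_lt _ (by omega : n < k)]
    exact hasDerivAt_const t 0

theorem coeff_eq_zero_of_hasDerivAt_orthPoly {n k : ℕ} {t : ℝ} {f : ℂ[X]}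
    (hf : ∀ k, HasDerivAt (fun s => (orthPoly (fun k => a k s) n).coeff k) (f.coeff k) t)
    (hk : n < k) : f.coeff k = 0 := by
  have h := hf k
  simp only [coeff_orthPoly_of_lt _ hk] at h
  exact h.unique (hasDerivAt_const t 0)

theorem hasDerivAt_momentFunctional_orthPoly
    (ha : ∀ k t, HasDerivAt (a k) (a (k + 1) t) t) {n : ℕ} {t : ℝ} {f : ℂ[X]}
    (hf : ∀ k, HasDerivAt (fun s => (orthPoly (fun k => a k s) n).coeff k) (f.coeff k) t)
    (i : ℕ) :
    HasDerivAt
      (fun s => momentFunctional (fun k => a k s) (orthPoly (fun k => a k s) n * X ^ i))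
      (momentFunctional (fun k => a k t) (f * X ^ i)
        + momentFunctional (fun k => a k t) (orthPoly (fun k => a k t) n * X ^ (i + 1))) t := by
  have hd : f.natDegree < n + 1 := Nat.lt_succ_of_le <|
    natDegree_le_iff_coeff_eq_zero.2 fun k hk => coeff_eq_zero_of_hasDerivAt_orthPoly hf hk
  have e := fun s => momentFunctional_mul_X_pow (fun k => a k s)
    (natDegree_orthPoly_lt (fun k => a k s) n)
  simp only [e, momentFunctional_mul_X_pow _ hd]
  rw [← Finset.sum_add_distrib]
  exact HasDerivAt.fun_sum fun k _ => (hf k).mul (ha (k + i) t)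

variable {m : ℕ} {t : ℝ}

theorem momentFunctional_orthPoly_deriv_add (ha : ∀ k t, HasDerivAt (a k) (a (k + 1) t) t)
    {n i : ℕ} {f : ℂ[X]} (hi : i < n)
    (hf : ∀ k, HasDerivAt (fun s => (orthPoly (fun k => a k s) n).coeff k) (f.coeff k) t) :
    momentFunctional (fun k => a k t) (f * X ^ i)
      + momentFunctional (fun k => a k t) (orthPoly (fun k => a k t) n * X ^ (i + 1)) = 0 := by
  have h := hasDerivAt_momentFunctional_orthPoly ha hf i
  simp only [momentFunctional_orthPoly_of_lt _ hi] at h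
  exact h.unique (hasDerivAt_const t 0)

theorem hankel_toda_flow (ha : ∀ k t, HasDerivAt (a k) (a (k + 1) t) t)
    (h1 : (hankel (fun k => a k t) (m + 1)).det ≠ 0) {f : ℂ[X]}
    (hf : ∀ k, HasDerivAt (fun s => (orthPoly (fun k => a k s) (m + 1)).coeff k) (f.coeff k) t) :
    C (hankel (fun k => a k t) (m + 1)).det * f
        - C (momentFunctional (fun k => a k t) (orthPoly (fun k => a k t) m * X ^ (m + 1)))
          * orthPoly (fun k => a k t) (m + 1) =
      -(C (hankel (fun k => a k t) (m + 2)).det * orthPoly (fun k => a k t) m) := by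
  refine toda_flow_orthPoly h1 (fun k hk => coeff_eq_zero_of_hasDerivAt_orthPoly hf hk) ?_
    fun i hi => momentFunctional_orthPoly_deriv_add ha hi hf
  have h := hf (m + 1)
  simp only [coeff_orthPoly_self] at h
  exact h.unique (hasDerivAt_hankel_det ha m t)

/-- The Toda equation for Hankel determinants. -/
theorem hasDerivAt_hankel_toda (ha : ∀ k t, HasDerivAt (a k) (a (k + 1) t) t)
    (h1 : (hankel (fun k => a k t) (m + 1)).det ≠ 0) :
    ∃ d, HasDerivAt (fun s => momentFunctional (fun k => a k s)
        (orthPoly (fun k => a k s) m * X ^ (m + 1))) d t ∧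
      (hankel (fun k => a k t) (m + 1)).det * d
        - momentFunctional (fun k => a k t) (orthPoly (fun k => a k t) m * X ^ (m + 1)) ^ 2 =
      (hankel (fun k => a k t) (m + 2)).det * (hankel (fun k => a k t) m).det := by
  obtain ⟨f, hf⟩ := exists_hasDerivAt_orthPoly ha (m + 1) t
  refine ⟨-f.coeff m, (hf m).fun_neg.congr_of_eventuallyEq ?_, ?_⟩
  · filter_upwards [(hasDerivAt_hankel_det ha m t).continuousAt.eventually_ne h1] with s hs
    rw [coeff_orthPoly_sub_one hs, neg_neg]
  · have h := congrArg (fun g => coeff g m) (hankel_toda_flow ha h1 hf)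
    simp only [coeff_sub, coeff_neg, coeff_C_mul, coeff_orthPoly_self,
      coeff_orthPoly_sub_one h1] at h
    linear_combination -h

theorem hasDerivAt_hankel_shift (ha : ∀ k t, HasDerivAt (a k) (a (k + 1) t) t)
    (h1 : (hankel (fun k => a k t) (m + 1)).det ≠ 0) :
    ∃ d, HasDerivAt (fun s => (hankel (fun k => a (k + 1) s) (m + 1)).det) d t ∧
      (hankel (fun k => a k t) (m + 1)).det * d
        - momentFunctional (fun k => a k t) (orthPoly (fun k => a k t) m * X ^ (m + 1))
          * (hankel (fun k => a (k + 1) t) (m + 1)).det =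
      (hankel (fun k => a k t) (m + 2)).det * (hankel (fun k => a (k + 1) t) m).det := by
  obtain ⟨f, hf⟩ := exists_hasDerivAt_orthPoly ha (m + 1) t
  have hpow : ((-1 : ℂ) ^ m) * (-1) ^ m = 1 := by rw [← mul_pow]; simp
  refine ⟨(-1) ^ (m + 1) * f.coeff 0, ?_, ?_⟩
  · refine ((hf 0).const_mul ((-1 : ℂ) ^ (m + 1))).congr_of_eventuallyEq
      (Filter.Eventually.of_forall fun s => ?_)
    simp only
    rw [coeff_zero_orthPoly]
    linear_combination -(hankel (fun k => a (k + 1) s) (m + 1)).det * hpow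
  · have h := congrArg (fun g => coeff g 0) (hankel_toda_flow ha h1 hf)
    simp only [coeff_sub, coeff_neg, coeff_C_mul, coeff_zero_orthPoly] at h
    linear_combination (-1) ^ (m + 1) * h +
      ((hankel (fun k => a k t) (m + 2)).det * (hankel (fun k => a (k + 1) t) m).det
        + momentFunctional (fun k => a k t) (orthPoly (fun k => a k t) m * X ^ (m + 1))
          * (hankel (fun k => a (k + 1) t) (m + 1)).det) * hpow

theorem hasDerivAt_hankel_shift_pred (ha : ∀ k t, HasDerivAt (a k) (a (k + 1) t) t)
    (h1 : (hankel (fun k => a k t) (m + 1)).det ≠ 0) :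
    ∃ d, HasDerivAt (fun s => (hankel (fun k => a (k + 1) s) m).det) d t ∧
      momentFunctional (fun k => a k t) (orthPoly (fun k => a k t) m * X ^ (m + 1))
          * (hankel (fun k => a (k + 1) t) m).det
        - (hankel (fun k => a k t) (m + 1)).det * d =
      (hankel (fun k => a k t) m).det * (hankel (fun k => a (k + 1) t) (m + 1)).det := by
  obtain ⟨f, hf⟩ := exists_hasDerivAt_orthPoly ha m t
  have hpow : ((-1 : ℂ) ^ m) * (-1) ^ m = 1 := by rw [← mul_pow]; simp
  refine ⟨(-1) ^ m * f.coeff 0, ?_, ?_⟩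
  · refine ((hf 0).const_mul ((-1 : ℂ) ^ m)).congr_of_eventuallyEq
      (Filter.Eventually.of_forall fun s => ?_)
    simp only
    rw [coeff_zero_orthPoly]
    linear_combination -(hankel (fun k => a (k + 1) s) m).det * hpow
  · have hflow := toda_flow_orthPoly_pred h1
      (fun k hk => coeff_eq_zero_of_hasDerivAt_orthPoly hf hk) rfl fun i hi => by
        obtain rfl | hi' : i = m ∨ i < m := by omega
        · have h := hasDerivAt_momentFunctional_orthPoly ha hf i
          simp only [momentFunctional_orthPoly_self] at h
          rw [if_pos rfl]
          exact h.unique (hasDerivAt_hankel_det ha i t)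
        · rw [if_neg (by omega), momentFunctional_orthPoly_deriv_add ha hi' hf]
    have h := congrArg (fun g => coeff g 0) hflow
    simp only [coeff_sub, coeff_C_mul, coeff_zero_orthPoly, coeff_X_mul_zero] at h
    linear_combination (-1) ^ m * h +
      ((hankel (fun k => a k t) m).det * (hankel (fun k => a (k + 1) t) (m + 1)).det
        - momentFunctional (fun k => a k t) (orthPoly (fun k => a k t) m * X ^ (m + 1))
          * (hankel (fun k => a (k + 1) t) m).det) * hpow

end TodaFlow

/-- The determinants of the Hankel matrices of a sequence closed under differentiation and
satisfying a three-term recurrence solve the system `S_IV`. -/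
theorem hasDerivAt_hankel_quotient {ν : ℂ} {a : ℕ → ℝ → ℂ}
    (ha : ∀ k t, HasDerivAt (a k) (a (k + 1) t) t) {t : ℝ}
    (hrec : ∀ k : ℕ, a (k + 2) t = t * a (k + 1) t - (ν - k) * a k t)
    {T S : ℕ → ℝ → ℂ} (hT : ∀ n t, T n t = (hankel (fun k => a k t) n).det)
    (hS : ∀ n t, S n t = (hankel (fun k => a (k + 1) t) n).det) {m : ℕ}
    (h1 : T (m + 1) t ≠ 0) (h2 : T (m + 2) t ≠ 0) (h3 : S (m + 1) t ≠ 0) {q p : ℝ → ℂ}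
    (hq : ∀ t, q t = deriv (T (m + 2)) t / T (m + 2) t
      - deriv (T (m + 1)) t / T (m + 1) t - (t : ℂ))
    (hp : ∀ t, p t = T (m + 2) t * S m t / (S (m + 1) t * T (m + 1) t)) :
    HasDerivAt q (2 * q t * p t - ((q t) ^ 2 + (t : ℂ) * q t + (ν + 1))) t ∧
      HasDerivAt p (-((p t) ^ 2 - (2 * q t + (t : ℂ)) * p t + ((m + 1 : ℕ) : ℂ))) t := by
  obtain rfl : T = fun n t => (hankel (fun k => a k t) n).det := funext₂ hT
  obtain rfl : S = fun n t => (hankel (fun k => a (k + 1) t) n).det := funext₂ hS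
  simp only at h1 h2 h3 hp
  have hA := hasDerivAt_hankel_det ha m
  have hB := hasDerivAt_hankel_det ha (m + 1)
  obtain ⟨a2, hA2, tA⟩ := hasDerivAt_hankel_toda ha h1
  obtain ⟨b2, hB2, tB⟩ := hasDerivAt_hankel_toda (m := m + 1) ha h2
  obtain ⟨s1, hs1, ts⟩ := hasDerivAt_hankel_shift ha h1
  obtain ⟨r1, hr1, tr⟩ := hasDerivAt_hankel_shift_pred ha h1
  have e1 := hankel_string_equation_zero hrec h1
  have e2 := hankel_string_equation_sum hrec h1 h2 rfl
  have hq' : ∀ t, q t = _ := fun t => by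
    rw [hq t, (hA t).deriv, (hB t).deriv]
  have dq := ((hB2.fun_div (hB t) h2).fun_sub (hA2.fun_div (hA t) h1)).fun_sub
    (hasDerivAt_id t).ofReal_comp
  have dp := ((hB t).fun_mul hr1).fun_div (hs1.fun_mul (hA t)) (mul_ne_zero h3 h1)
  obtain rfl := funext hq'
  obtain rfl := funext hp
  simp only [id, Nat.add_assoc, Nat.reduceAdd, Complex.ofReal_one, Nat.cast_add, Nat.cast_one]
    at dq dp hA hB tA tB ts tr e1 e2 h1 h2 h3 ⊢
  generalize momentFunctional (fun k => a k t) (orthPoly (fun k => a k t) m * _) = A1 at *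
  generalize momentFunctional (fun k => a k t) (orthPoly (fun k => a k t) (m + 1) * _) = B1 at *
  generalize (hankel (fun k => a k t) m).det = Z at *
  generalize (hankel (fun k => a k t) (m + 1)).det = A at *
  generalize (hankel (fun k => a k t) (m + 2)).det = B at *
  generalize (hankel (fun k => a k t) (m + 3)).det = W at *
  generalize (hankel (fun k => a (k + 1) t) m).det = r at *
  generalize (hankel (fun k => a (k + 1) t) (m + 1)).det = s at *
  have hqp : (B1 / B - A1 / A - t) * (B * r / (s * A)) = (m + 1) - B * Z / A ^ 2 := by
    field_simp
    linear_combination -e1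
  have hα : (B1 / B - A1 / A) ^ 2 - t * (B1 / B - A1 / A) + B * Z / A ^ 2 + W * A / B ^ 2 =
      2 * (m + 1) - ν := by
    field_simp
    linear_combination e2
  have hb : (b2 * B - B1 * B1) / B ^ 2 = W * A / B ^ 2 := by
    congr 1
    linear_combination tB
  have hc : (a2 * A - A1 * A1) / A ^ 2 = B * Z / A ^ 2 := by
    congr 1
    linear_combination tA
  have hd : ((B1 * r + B * r1) * (s * A) - B * r * (s1 * A + s * A1)) / (s * A) ^ 2 =
      (B1 / B - A1 / A) * (B * r / (s * A)) - (B * r / (s * A)) ^ 2 - B * Z / A ^ 2 := by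
    field_simp
    linear_combination -B * s * tr - B * r * ts
  refine ⟨dq.congr_deriv ?_, dp.congr_deriv ?_⟩
  · rw [hb, hc]
    linear_combination -2 * hqp + hα
  · rw [hd]
    linear_combination -hqp

/-- the pair `q = (d/dt) log(τ_{n+1}^{ν}/τ_n^{ν}) - t`,
`p = τ_{n+1}^{ν}τ_{n-1}^{ν-1}/(τ_n^{ν-1}τ_n^{ν})` gives a solution of the
Hamiltonian system S_IV with `κ₀ = ν+1`, `θ∞ = n`. -/
theorem pIV_det_solution_two
    (ν : ℂ) (hν : ν ∉ Set.range ((↑·) : ℤ → ℂ))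
    (φ : ℤ → ℝ → ℂ)
    (hsmooth : ∀ j : ℤ, ContDiff ℝ (⊤ : ℕ∞) (φ j))
    (hdown : ∀ (j : ℤ) (t : ℝ), deriv (φ j) t = -((t : ℂ) / 2) * φ j t + φ (j - 1) t)
    (hup : ∀ (j : ℤ) (t : ℝ),
      deriv (φ j) t = ((t : ℂ) / 2) * φ j t - (ν + j + 1) * φ (j + 1) t)
    (τ : ℤ → ℤ → ℝ → ℂ)
    (hτ : ∀ (j m : ℤ) (t : ℝ), τ j m t =
      if m < 0 then 0
      else Matrix.det (Matrix.of fun k l : Fin m.toNat =>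
        deriv^[(k : ℕ) + (l : ℕ)] (fun s : ℝ => Complex.exp ((s : ℂ) ^ 2 / 4) * φ j s) t))
    (n : ℕ) (U : Set ℝ) (hU : IsOpen U)
    (hden1 : ∀ t ∈ U, τ 0 (n + 1) t ≠ 0)
    (hden2 : ∀ t ∈ U, τ 0 n t ≠ 0)
    (hden3 : ∀ t ∈ U, τ (-1) n t ≠ 0)
    (q p : ℝ → ℂ)
    (hq : ∀ t, q t = deriv (τ 0 (n + 1)) t / τ 0 (n + 1) t
      - deriv (τ 0 n) t / τ 0 n t - (t : ℂ))
    (hp : ∀ t, p t = τ 0 (n + 1) t * τ (-1) (n - 1) t / (τ (-1) n t * τ 0 n t)) :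
    ∀ t ∈ U,
      deriv q t = 2 * q t * p t - ((q t) ^ 2 + (t : ℂ) * q t + (ν + 1)) ∧
      deriv p t = -((p t) ^ 2 - (2 * q t + (t : ℂ)) * p t + (n : ℂ)) := by
  have hder : ∀ (j : ℤ) (t : ℝ), HasDerivAt (fun s : ℝ => Complex.exp ((s : ℂ) ^ 2 / 4) * φ j s)
      (Complex.exp ((t : ℂ) ^ 2 / 4) * φ (j - 1) t) t := by
    intro j t
    have hφ := ((hsmooth j).differentiable (by simp) t).hasDerivAt
    have hexp : HasDerivAt (fun s : ℝ => Complex.exp ((s : ℂ) ^ 2 / 4))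
        (Complex.exp ((t : ℂ) ^ 2 / 4) * (t / 2)) t := by
      have h := (((hasDerivAt_id t).ofReal_comp.fun_pow 2).div_const 4).cexp
      refine h.congr_deriv ?_
      simp
      ring
    refine (hexp.fun_mul hφ).congr_deriv ?_
    rw [hdown]
    ring
  have hiter : ∀ (k : ℕ) (j : ℤ),
      deriv^[k] (fun s : ℝ => Complex.exp ((s : ℂ) ^ 2 / 4) * φ j s) =
        fun s : ℝ => Complex.exp ((s : ℂ) ^ 2 / 4) * φ (j - k) s := by
    intro k
    induction k with
    | zero => simp
    | succ k ih =>
      intro j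
      rw [Function.iterate_succ_apply, funext fun t => (hder j t).deriv, ih]
      funext s
      congr 2
      push_cast
      ring
  set a : ℕ → ℝ → ℂ := fun k s => Complex.exp ((s : ℂ) ^ 2 / 4) * φ (-k) s with ha_def
  have ha : ∀ k t, HasDerivAt (a k) (a (k + 1) t) t := fun k t =>
    (hder (-k) t).congr_deriv (by simp only [ha_def]; congr 2; push_cast; ring)
  have hrec : ∀ (t : ℝ) (k : ℕ), a (k + 2) t = t * a (k + 1) t - (ν - k) * a k t := by
    intro t k
    have h := (hdown (-k - 1) t).symm.trans (hup (-k - 1) t)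
    rw [sub_add_cancel] at h
    simp only [ha_def]
    rw [show -((k + 2 : ℕ) : ℤ) = -k - 1 - 1 by push_cast; ring,
      show -((k + 1 : ℕ) : ℤ) = -k - 1 by push_cast; ring]
    push_cast at h
    linear_combination Complex.exp ((t : ℂ) ^ 2 / 4) * h
  have hT : ∀ (n : ℕ) (t : ℝ), τ 0 n t = (hankel (fun k => a k t) n).det := by
    intro n t
    rw [hτ, if_neg (by omega)]
    simp only [hiter, zero_sub]
    rfl
  have hS : ∀ (n : ℕ) (t : ℝ), τ (-1) n t = (hankel (fun k => a (k + 1) t) n).det := by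
    intro n t
    rw [hτ, if_neg (by omega)]
    simp only [hiter, ha_def, hankel]
    congr 1
    ext i j
    simp only [Matrix.of_apply]
    congr 2
    push_cast
    ring
  intro t ht
  obtain _ | m := n
  · have hT0 : ∀ t, τ 0 0 t = 1 := fun t => by simpa using hT 0 t
    have hT1 : τ 0 1 = a 0 := funext fun t => by simpa [hankel] using hT 1 t
    have hS0 : ∀ t, τ (-1) (-1) t = 0 := fun t => by rw [hτ, if_pos (by norm_num)]
    simp only [Nat.cast_zero, zero_add, zero_sub, hS0, mul_zero, zero_div] at hp hq hden1
    have hT0' : ∀ t, deriv (τ 0 0) t = 0 := fun t => by rw [funext hT0, deriv_const]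
    have h0 := hden1 t ht
    simp only [hT0', hT1, zero_div, sub_zero, (ha 0 _).deriv, zero_add] at hq h0
    have hr := hrec t 0
    obtain rfl := funext hq
    obtain rfl := funext hp
    refine ⟨?_, by simp⟩
    refine ((((ha 1 t).fun_div (ha 0 t) h0).fun_sub
      (hasDerivAt_id t).ofReal_comp).congr_deriv ?_).deriv
    simp only [zero_add, Nat.cast_zero, sub_zero, Nat.reduceAdd] at hr ⊢
    rw [hr]
    simp only [Complex.ofReal_one]
    field_simp
    ring
  · have h := hasDerivAt_hankel_quotient (T := fun n => τ 0 n) (S := fun n => τ (-1) n) (m := m)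
      ha (hrec t) hT hS (hden2 t ht) (by simpa [add_assoc] using hden1 t ht) (hden3 t ht)
      (q := q) (p := p) (by simpa [add_assoc] using hq) (by simpa [add_assoc] using hp)
    exact ⟨h.1.deriv, h.2.deriv⟩
end

section
/- With the family (φ_μ) as in the context, at every point t where φ_ν(t) ≠ 0, the triple (f_0, f_1, f_2) = (0, φ_{ν−1}/φ_ν, (ν+1)·φ_{ν+1}/φ_ν) gives a (Riccati) solution of the symmetric form of the Painlevé IV equation with parameters (α_0, α_1, α_2) = (0, −ν, ν+1); in particular f_0 + f_1 + f_2 = t. -/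
/-- for a family `(φ_{ν+j})` of parabolic-cylinder-type functions
satisfying the contiguity relations, `(f₀,f₁,f₂) = (0, φ_{ν-1}/φ_ν, (ν+1)φ_{ν+1}/φ_ν)`
is a Riccati solution of the symmetric form of P_IV with
`(α₀,α₁,α₂) = (0, -ν, ν+1)`; in particular `f₀ + f₁ + f₂ = t`. -/
theorem pIV_riccati_solution
    (ν : ℂ) (hν : ν ∉ Set.range ((↑·) : ℤ → ℂ))
    (φ : ℤ → ℝ → ℂ)
    (hsmooth : ∀ j : ℤ, ContDiff ℝ (⊤ : ℕ∞) (φ j))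
    (hdown : ∀ (j : ℤ) (t : ℝ), deriv (φ j) t = -((t : ℂ) / 2) * φ j t + φ (j - 1) t)
    (hup : ∀ (j : ℤ) (t : ℝ),
      deriv (φ j) t = ((t : ℂ) / 2) * φ j t - (ν + j + 1) * φ (j + 1) t)
    (f₀ f₁ f₂ : ℝ → ℂ)
    (hf₀ : ∀ t, f₀ t = 0)
    (hf₁ : ∀ t, f₁ t = φ (-1) t / φ 0 t)
    (hf₂ : ∀ t, f₂ t = (ν + 1) * φ 1 t / φ 0 t) :
    ∀ t : ℝ, φ 0 t ≠ 0 →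
      deriv f₀ t = f₀ t * (f₁ t - f₂ t) + 0 ∧
      deriv f₁ t = f₁ t * (f₂ t - f₀ t) + (-ν) ∧
      deriv f₂ t = f₂ t * (f₀ t - f₁ t) + (ν + 1) ∧
      f₀ t + f₁ t + f₂ t = (t : ℂ) := by
  intro t ht
  have hd (j : ℤ) : DifferentiableAt ℝ (φ j) t := (hsmooth j).differentiable (by simp) t
  have hsum : φ (-1) t + (ν + 1) * φ 1 t = t * φ 0 t := by
    have h₁ := hdown 0 t
    have h₂ := hup 0 t
    norm_num at h₁ h₂
    linear_combination h₂ - h₁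
  have hup₀ : deriv (φ 0) t = (t : ℂ) / 2 * φ 0 t - (ν + 1) * φ 1 t := by
    simpa using hup 0 t
  have hup₁ : deriv (φ (-1)) t = (t : ℂ) / 2 * φ (-1) t - ν * φ 0 t := by
    simpa using hup (-1) t
  have hdown₁ : deriv (φ 1) t = -((t : ℂ) / 2) * φ 1 t + φ 0 t := by
    simpa using hdown 1 t
  have hderiv₁ := ((hd (-1)).hasDerivAt.div (hd 0).hasDerivAt ht).deriv
  have hderiv₂ := (((hd 1).hasDerivAt.const_mul (ν + 1)).div (hd 0).hasDerivAt ht).deriv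
  obtain rfl : f₀ = fun _ => 0 := funext hf₀
  obtain rfl : f₁ = φ (-1) / φ 0 := funext hf₁
  obtain rfl : f₂ = (fun s => (ν + 1) * φ 1 s) / φ 0 := funext hf₂
  refine ⟨by simp, ?_, ?_, ?_⟩
  · rw [hderiv₁, hup₁, hup₀]
    simp only [Pi.div_apply]
    field_simp
    ring
  · rw [hderiv₂, hdown₁, hup₀]
    simp only [Pi.div_apply]
    field_simp
    linear_combination 2 * (ν + 1) * φ 1 t * hsum
  · simp only [Pi.div_apply]
    field_simp
    linear_combination hsum
end

section
/- With the family (φ_μ) and the Hankel determinants τ_n^{μ} as in the context, for every integer n ≥ 0, on every open interval on which none of the τ-functions appearing in the denominators vanishes, the functions f_0 = τ_{n+1}^{ν}τ_{n−1}^{ν−1}/(τ_n^{ν−1}τ_n^{ν}), f_1 = τ_n^{ν}τ_{n+1}^{ν−1}/(τ_{n+1}^{ν}τ_n^{ν−1}), f_2 = (ν+1)·τ_n^{ν−1}τ_{n+1}^{ν+1}/(τ_n^{ν}τ_{n+1}^{ν}) give a solution of the symmetric form of the Painlevé IV equation with parameters (α_0, α_1, α_2) = (−n, −ν+n, ν+1);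 moreover the alternative expressions f_0 = (d/dt) log(τ_n^{ν−1}/τ_n^{ν}), f_1 = (d/dt) log(τ_{n+1}^{ν}/τ_n^{ν−1}), and f_2 = (d/dt) log(τ_n^{ν}/τ_{n+1}^{ν}) + t hold. -/
/-- The determinant of the matrix with rows `M`, `u`, `v`. -/
def borderDet {R : Type*} [CommRing R] {m : ℕ} (M : Fin m → Fin (m + 2) → R)
    (u v : Fin (m + 2) → R) : R :=
  Matrix.detRowAlternating
    (Fin.snoc (Fin.snoc M u : Fin (m + 1) → Fin (m + 2) → R) v : Fin (m + 2) → Fin (m + 2) → R)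

section BorderDet

variable {R : Type*} [CommRing R] {m : ℕ} (M : Fin m → Fin (m + 2) → R)

theorem exists_linearMap_borderDet (z : Fin (m + 2) → R) :
    ∃ L : (Fin (m + 2) → R) →ₗ[R] R, ∀ x, L x = borderDet M x z := by
  refine ⟨Matrix.detRowAlternating.toMultilinearMap.toLinearMap
    (Fin.snoc (Fin.snoc M 0 : Fin (m + 1) → Fin (m + 2) → R) z) (Fin.last m).castSucc, ?_⟩
  intro x
  simp only [MultilinearMap.toLinearMap_apply]
  rw [← Fin.snoc_update, Fin.update_snoc_last]
  rfl

theorem borderDet_swap (u v : Fin (m + 2) → R) : borderDet M u v = -borderDet M v u := by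
  unfold borderDet
  rw [← AlternatingMap.map_swap _ _ (Fin.castSucc_lt_last (Fin.last m)).ne]
  congr 1
  funext i
  simp only [Function.comp_apply]
  induction i using Fin.lastCases with
  | last => rw [Equiv.swap_apply_right]; simp only [Fin.snoc_last, Fin.snoc_castSucc]
  | cast i =>
    induction i using Fin.lastCases with
    | last => rw [Equiv.swap_apply_left]; simp only [Fin.snoc_last, Fin.snoc_castSucc]
    | cast i =>
      rw [Equiv.swap_apply_of_ne_of_ne (by simp [Fin.ext_iff, i.2.ne])
        (Fin.castSucc_lt_last _).ne]
      simp only [Fin.snoc_castSucc]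

theorem borderDet_row (i : Fin m) (z : Fin (m + 2) → R) : borderDet M (M i) z = 0 := by
  refine AlternatingMap.map_eq_zero_of_eq _ _
    (i := i.castSucc.castSucc) (j := (Fin.last m).castSucc) ?_ ?_
  · simp only [Fin.snoc_castSucc, Fin.snoc_last]
  · simp [Fin.ext_iff, i.2.ne]

theorem sum_detRowAlternating_update_smul {k : ℕ} (A : Fin k → Fin k → R) (u : Fin k → R) :
    ∑ i, Matrix.detRowAlternating (Function.update A i u) • A i
      = Matrix.detRowAlternating A • u := by
  have key := Matrix.mulVec_cramer (Matrix.of A).transpose u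
  rw [Matrix.mulVec_transpose, Matrix.vecMul_eq_sum, Matrix.det_transpose] at key
  simp only [Matrix.cramer_transpose_apply] at key
  exact key

/-- The three-term Plücker relation. -/
theorem borderDet_plucker (u v w z : Fin (m + 2) → R) :
    borderDet M u v * borderDet M w z - borderDet M u w * borderDet M v z
      + borderDet M u z * borderDet M v w = 0 := by
  obtain ⟨L, hL⟩ := exists_linearMap_borderDet M z
  have key := congrArg L (sum_detRowAlternating_update_smul
    (Fin.snoc (Fin.snoc M v : Fin (m + 1) → Fin (m + 2) → R) w) u)
  rw [Fin.sum_univ_castSucc, Fin.sum_univ_castSucc] at key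
  simp only [map_add, map_sum, map_smul] at key
  simp only [← Fin.snoc_update, Fin.update_snoc_last, hL, Fin.snoc_castSucc, Fin.snoc_last,
    borderDet_row, smul_eq_mul, mul_zero, Finset.sum_const_zero, zero_add] at key
  change borderDet M u w * _ + borderDet M v u * _ = borderDet M v w * _ at key
  rw [borderDet_swap M v u] at key
  linear_combination -key

theorem detRowAlternating_eq_det_of {k : ℕ} (A : Fin k → Fin k → R) :
    Matrix.detRowAlternating A = (Matrix.of A).det := rfl

theorem detRowAlternating_snoc_single_last {k : ℕ} (r : Fin k → Fin (k + 1) → R) :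
    Matrix.detRowAlternating (Fin.snoc r (Pi.single (Fin.last k) 1) :
      Fin (k + 1) → Fin (k + 1) → R) =
      Matrix.detRowAlternating fun i j => r i (Fin.castSucc j) := by
  rw [detRowAlternating_eq_det_of, detRowAlternating_eq_det_of,
    Matrix.det_succ_row _ (Fin.last k), Finset.sum_eq_single (Fin.last k)]
  · rw [Matrix.of_apply, Fin.snoc_last, Pi.single_eq_same, Fin.val_last, ← two_mul, pow_mul]
    simp only [even_two, Even.neg_pow, one_pow, mul_one, one_mul]
    congr 1
    ext i j
    simp [Matrix.submatrix]
  · intro j _ hj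
    simp [hj]
  · simp

theorem detRowAlternating_snoc_single_zero {k : ℕ} (r : Fin k → Fin (k + 1) → R) :
    Matrix.detRowAlternating (Fin.snoc r (Pi.single 0 1) : Fin (k + 1) → Fin (k + 1) → R) =
      (-1) ^ k * Matrix.detRowAlternating fun i j => r i (Fin.succ j) := by
  rw [detRowAlternating_eq_det_of, detRowAlternating_eq_det_of,
    Matrix.det_succ_row _ (Fin.last k), Finset.sum_eq_single 0]
  · rw [Matrix.of_apply, Fin.snoc_last, Pi.single_eq_same, Fin.val_last, Fin.val_zero, add_zero,
      mul_one]
    congr 2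
    ext i j
    simp [Matrix.submatrix]
  · intro j _ hj
    simp [hj]
  · simp

theorem detRowAlternating_cons {k : ℕ} (N : Fin k → Fin (k + 1) → R) (u : Fin (k + 1) → R) :
    Matrix.detRowAlternating (Fin.cons u N : Fin (k + 1) → Fin (k + 1) → R) =
      (-1) ^ k * Matrix.detRowAlternating (Fin.snoc N u : Fin (k + 1) → Fin (k + 1) → R) := by
  have h := AlternatingMap.map_perm (Matrix.detRowAlternating (R := R))
    (Fin.cons u N : Fin (k + 1) → Fin (k + 1) → R) (finRotate (k + 1))
  rw [sign_finRotate] at h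
  rw [Fin.snoc_eq_cons_rotate]
  rw [show (fun i => (Fin.cons u N : Fin (k + 1) → Fin (k + 1) → R) (finRotate _ i)) =
    (Fin.cons u N : Fin (k + 1) → Fin (k + 1) → R) ∘ (finRotate (k + 1)) from rfl, h]
  simp [Units.smul_def, ← mul_assoc, ← mul_pow]

theorem trace_mul_adjugate {k : ℕ} (X H : Fin k → Fin k → R) :
    (Matrix.of X * (Matrix.of H).adjugate).trace =
      ∑ i, Matrix.detRowAlternating (Function.update H i (X i)) := by
  unfold Matrix.trace
  refine Finset.sum_congr rfl fun i _ => ?_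
  have h := Matrix.cramer_transpose_apply (Matrix.of H) (X i) i
  rw [Matrix.cramer_eq_adjugate_mulVec, ← Matrix.adjugate_transpose,
    Matrix.mulVec_transpose] at h
  exact h

end BorderDet

theorem hasDerivAt_detRowAlternating {k : ℕ} {M : Fin k → Fin k → ℝ → ℂ} {M' : Fin k → Fin k → ℂ}
    {t : ℝ} (h : ∀ i j, HasDerivAt (M i j) (M' i j) t) :
    HasDerivAt (fun s => Matrix.detRowAlternating fun i j => M i j s)
      (∑ i, Matrix.detRowAlternating (Function.update (fun i j => M i j t) i (M' i))) t := by
  have expand : ∀ N : Fin k → Fin k → ℂ, Matrix.detRowAlternating N =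
      ∑ σ : Equiv.Perm (Fin k), ((σ.sign : ℤ) : ℂ) * ∏ i, N i (σ i) := fun N => by
    change Matrix.det (Matrix.of N) = _
    rw [← Matrix.det_transpose, Matrix.det_apply']
    rfl
  simp only [expand]
  have := HasDerivAt.fun_sum (u := Finset.univ) (x := t) fun (σ : Equiv.Perm (Fin k)) _ =>
    (HasDerivAt.fun_finsetProd (u := Finset.univ) fun i _ => h i (σ i)).const_mul
      ((σ.sign : ℤ) : ℂ)
  refine this.congr_deriv ?_
  rw [Finset.sum_comm]
  refine Finset.sum_congr rfl fun σ _ => ?_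
  rw [Finset.mul_sum]
  refine Finset.sum_congr rfl fun i _ => ?_
  congr 1
  rw [← Finset.prod_erase_mul _ _ (Finset.mem_univ i), smul_eq_mul, Function.update_self]
  congr 1
  refine Finset.prod_congr rfl fun j hj => ?_
  rw [Function.update_of_ne (Finset.ne_of_mem_erase hj)]

/-- The row `(c s, c (s + 1), …, c (s + n - 1))`. -/
def hankelRow {R : Type*} (c : ℤ → R) (n : ℕ) (s : ℤ) : Fin n → R := fun l => c (s + l)

/-- The determinant of the matrix with entries `c (s k + l)`. -/
def hankelMinor {R : Type*} [CommRing R] (c : ℤ → R) {n : ℕ} (s : Fin n → ℤ) : R :=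
  Matrix.detRowAlternating (hankelRow c n ∘ s)

/-- The consecutive indices `b, b + 1, …, b + n - 1`. -/
def consec (n : ℕ) (b : ℤ) : Fin n → ℤ := fun k => b + k

theorem consec_succ (n : ℕ) (b : ℤ) : consec (n + 1) b = Fin.snoc (consec n b) (b + n) := by
  funext i
  induction i using Fin.lastCases <;> simp [consec]

theorem consec_succ' (n : ℕ) (b : ℤ) :
    consec (n + 1) b = Fin.cons b (consec n (b + 1)) := by
  funext i
  induction i using Fin.cases
  · simp [consec]
  · simp [consec]; ring

theorem consec_add_one (n : ℕ) (b : ℤ) : (fun i => consec n b i + 1) = consec n (b + 1) := by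
  funext i
  simp only [consec]
  ring

section HankelMinor

variable {R : Type*} [CommRing R] (c : ℤ → R)

/-- The Hankel determinant `det (c (b + k + l))` of size `n`. -/
def hankelDet (n : ℕ) (b : ℤ) : R := hankelMinor c (consec n b)

/-- The Hankel determinant of size `n` with row indices `b, …, b + n - 2, b + n`. -/
def hankelDetOne : (n : ℕ) → (b : ℤ) → R
  | 0, _ => 0
  | m + 1, b => hankelMinor c (Fin.snoc (consec m b) (b + m + 1) : Fin (m + 1) → ℤ)

/-- The Hankel determinant of size `n` with row indices `b, …, b + n - 3, b + n - 1, b + n`. -/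
def hankelDetOneOne : (n : ℕ) → (b : ℤ) → R
  | 0, _ => 0
  | 1, _ => 0
  | m + 2, b => hankelMinor c
      (Fin.snoc (Fin.snoc (consec m b) (b + m + 1) : Fin (m + 1) → ℤ) (b + m + 2) :
        Fin (m + 2) → ℤ)

/-- The Hankel determinant of size `n` with row indices `b, …, b + n - 2, b + n + 1`. -/
def hankelDetTwo : (n : ℕ) → (b : ℤ) → R
  | 0, _ => 0
  | m + 1, b => hankelMinor c (Fin.snoc (consec m b) (b + m + 2) : Fin (m + 1) → ℤ)

theorem hankelMinor_eq_zero {n : ℕ} (s : Fin n → ℤ) (i j : Fin n) (h : s i = s j) (hij : i ≠ j) :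
    hankelMinor c s = 0 :=
  AlternatingMap.map_eq_zero_of_eq _ _ (by simp [h]) hij

theorem hankelMinor_update {n : ℕ} (s : Fin n → ℤ) (i : Fin n) (x : ℤ) :
    hankelMinor c (Function.update s i x) =
      Matrix.detRowAlternating (Function.update (hankelRow c n ∘ s) i (hankelRow c n x)) := by
  rw [hankelMinor, Function.comp_update]

theorem hankelMinor_snoc_snoc {m : ℕ} (σ : Fin m → ℤ) (x y : ℤ) :
    hankelMinor c (Fin.snoc (Fin.snoc σ x : Fin (m + 1) → ℤ) y : Fin (m + 2) → ℤ) =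
      borderDet (hankelRow c (m + 2) ∘ σ) (hankelRow c _ x) (hankelRow c _ y) := by
  rw [hankelMinor, Fin.comp_snoc, Fin.comp_snoc, borderDet]

theorem hankelMinor_snoc_swap {m : ℕ} (σ : Fin m → ℤ) (x y : ℤ) :
    hankelMinor c (Fin.snoc (Fin.snoc σ x : Fin (m + 1) → ℤ) y : Fin (m + 2) → ℤ) =
      -hankelMinor c (Fin.snoc (Fin.snoc σ y : Fin (m + 1) → ℤ) x : Fin (m + 2) → ℤ) := by
  rw [hankelMinor_snoc_snoc, hankelMinor_snoc_snoc, borderDet_swap]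

theorem hankelMinor_cons {k : ℕ} (s : Fin k → ℤ) (x : ℤ) :
    hankelMinor c (Fin.cons x s : Fin (k + 1) → ℤ) =
      (-1) ^ k * hankelMinor c (Fin.snoc s x : Fin (k + 1) → ℤ) := by
  rw [hankelMinor, hankelMinor, Fin.comp_snoc, ← detRowAlternating_cons]
  congr 1
  funext i
  induction i using Fin.cases <;> rfl

theorem borderDet_single_last {m : ℕ} (σ : Fin m → ℤ) (x : ℤ) :
    borderDet (hankelRow c (m + 2) ∘ σ) (hankelRow c _ x) (Pi.single (Fin.last _) 1) =
      hankelMinor c (Fin.snoc σ x : Fin (m + 1) → ℤ) := by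
  rw [borderDet, ← Fin.comp_snoc, detRowAlternating_snoc_single_last]
  rfl

theorem borderDet_single_zero {m : ℕ} (σ : Fin m → ℤ) (x : ℤ) :
    borderDet (hankelRow c (m + 2) ∘ σ) (hankelRow c _ x) (Pi.single 0 1) =
      (-1) ^ (m + 1) *
        hankelMinor c (Fin.snoc (fun i => σ i + 1) (x + 1) : Fin (m + 1) → ℤ) := by
  rw [borderDet, ← Fin.comp_snoc, detRowAlternating_snoc_single_zero, hankelMinor]
  congr 2
  funext i j
  induction i using Fin.lastCases <;> simp [hankelRow] <;> congr 1 <;> ring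

theorem borderDet_single_zero_single_last {m : ℕ} (σ : Fin m → ℤ) :
    borderDet (hankelRow c (m + 2) ∘ σ) (Pi.single 0 1) (Pi.single (Fin.last _) 1) =
      (-1) ^ m * hankelMinor c (fun i => σ i + 1) := by
  rw [borderDet_swap, borderDet, detRowAlternating_snoc_single_zero]
  have : (fun (i : Fin (m + 1)) (j : Fin (m + 1)) =>
      (Fin.snoc (hankelRow c (m + 2) ∘ σ) (Pi.single (Fin.last _) 1) :
        Fin (m + 1) → Fin (m + 2) → R) i j.succ) =
      (Fin.snoc (fun i j => hankelRow c (m + 2) (σ i) j.succ) (Pi.single (Fin.last _) 1) :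
        Fin (m + 1) → Fin (m + 1) → R) := by
    funext i j
    induction i using Fin.lastCases with
    | last => simp [Pi.single_apply, ← Fin.succ_last]
    | cast i => simp
  rw [this, detRowAlternating_snoc_single_last, hankelMinor, pow_succ]
  simp only [mul_neg, mul_one, neg_mul, neg_neg]
  congr 2
  funext i j
  simp [hankelRow]
  congr 1
  ring

theorem plucker_last {m : ℕ} (σ : Fin m → ℤ) (p q r : ℤ) :
    hankelMinor c (Fin.snoc (Fin.snoc σ p : Fin (m + 1) → ℤ) q : Fin (m + 2) → ℤ) *
        hankelMinor c (Fin.snoc σ r : Fin (m + 1) → ℤ)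
      - hankelMinor c (Fin.snoc (Fin.snoc σ p : Fin (m + 1) → ℤ) r : Fin (m + 2) → ℤ) *
        hankelMinor c (Fin.snoc σ q : Fin (m + 1) → ℤ)
      + hankelMinor c (Fin.snoc σ p : Fin (m + 1) → ℤ) *
        hankelMinor c (Fin.snoc (Fin.snoc σ q : Fin (m + 1) → ℤ) r : Fin (m + 2) → ℤ) = 0 := by
  have h := borderDet_plucker (hankelRow c (m + 2) ∘ σ) (hankelRow c _ p) (hankelRow c _ q)
    (hankelRow c _ r) (Pi.single (Fin.last _) 1)
  simpa only [borderDet_single_last, ← hankelMinor_snoc_snoc] using h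

theorem plucker_zero {m : ℕ} (σ : Fin m → ℤ) (p q r : ℤ) :
    hankelMinor c (Fin.snoc (Fin.snoc σ p : Fin (m + 1) → ℤ) q : Fin (m + 2) → ℤ) *
        hankelMinor c (Fin.snoc (fun i => σ i + 1) (r + 1) : Fin (m + 1) → ℤ)
      - hankelMinor c (Fin.snoc (Fin.snoc σ p : Fin (m + 1) → ℤ) r : Fin (m + 2) → ℤ) *
        hankelMinor c (Fin.snoc (fun i => σ i + 1) (q + 1) : Fin (m + 1) → ℤ)
      + hankelMinor c (Fin.snoc (fun i => σ i + 1) (p + 1) : Fin (m + 1) → ℤ) *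
        hankelMinor c (Fin.snoc (Fin.snoc σ q : Fin (m + 1) → ℤ) r : Fin (m + 2) → ℤ) = 0 := by
  have h := borderDet_plucker (hankelRow c (m + 2) ∘ σ) (hankelRow c _ p) (hankelRow c _ q)
    (hankelRow c _ r) (Pi.single 0 1)
  simp only [borderDet_single_zero, ← hankelMinor_snoc_snoc] at h
  have hs : ((-1 : R) ^ (m + 1)) * (-1) ^ (m + 1) = 1 := by simp [← mul_pow]
  rw [← one_mul (_ + _), ← hs]
  linear_combination (-1) ^ (m + 1) * h

theorem sum_hankelMinor_update_one (n : ℕ) (b : ℤ) :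
    ∑ i, hankelMinor c (Function.update (consec n b) i (consec n b i + 1)) =
      hankelDetOne c n b := by
  rcases n with _ | m
  · simp [hankelDetOne]
  rw [Fin.sum_univ_castSucc, Finset.sum_eq_zero, zero_add]
  · rw [consec_succ, Fin.update_snoc_last, Fin.snoc_last, hankelDetOne]
  · intro i _
    refine hankelMinor_eq_zero c _ i.castSucc i.succ ?_ (Fin.castSucc_lt_succ).ne
    rw [Function.update_self, Function.update_of_ne (Fin.castSucc_lt_succ).ne']
    simp [consec]
    ring

theorem sum_hankelMinor_update_two (n : ℕ) (b : ℤ) :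
    ∑ i, hankelMinor c (Function.update (consec n b) i (consec n b i + 2)) =
      hankelDetTwo c n b - hankelDetOneOne c n b := by
  rcases n with _ | _ | m
  · simp [hankelDetTwo, hankelDetOneOne]
  · rw [Fin.sum_univ_castSucc, consec_succ, Fin.update_snoc_last, Fin.snoc_last]
    simp [hankelDetTwo, hankelDetOneOne]
  rw [Fin.sum_univ_castSucc, Fin.sum_univ_castSucc, Finset.sum_eq_zero, zero_add]
  · rw [consec_succ, Fin.update_snoc_last, Fin.snoc_last, Fin.snoc_castSucc, ← Fin.snoc_update,
      consec_succ, Fin.update_snoc_last, Fin.snoc_last, hankelMinor_snoc_swap, hankelDetOneOne,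
      hankelDetTwo, consec_succ]
    push_cast
    simp only [← add_assoc]
    ring
  · intro i _
    refine hankelMinor_eq_zero c _ i.castSucc.castSucc i.succ.succ ?_ ?_
    · rw [Function.update_self, Function.update_of_ne (by simp [Fin.ext_iff, add_assoc])]
      simp [consec]
      ring
    · simp [Fin.ext_iff, add_assoc]

theorem sum_hankelMinor_update_snoc (m : ℕ) (b : ℤ) (s : Fin (m + 1) → ℤ)
    (hs : s = Fin.snoc (consec m b) (b + m + 1)) :
    ∑ i, hankelMinor c (Function.update s i (s i + 1)) =
      hankelDetOneOne c (m + 1) b + hankelDetTwo c (m + 1) b := by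
  subst hs
  rw [Fin.sum_univ_castSucc]
  congr 1
  · rcases m with _ | m
    · simp [hankelDetOneOne]
    rw [Fin.sum_univ_castSucc, Finset.sum_eq_zero, zero_add]
    · rw [← Fin.snoc_update, Fin.snoc_castSucc, consec_succ, Fin.update_snoc_last, Fin.snoc_last,
        hankelDetOneOne]
      push_cast
      congr 2
      ring
    · intro i _
      refine hankelMinor_eq_zero c _ i.castSucc.castSucc i.succ.castSucc ?_ ?_
      · rw [Function.update_self, Function.update_of_ne (by simp [Fin.ext_iff])]
        simp only [Fin.snoc_castSucc]
        simp [consec]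
        ring
      · simp [Fin.ext_iff]
  · rw [Fin.update_snoc_last, Fin.snoc_last, hankelDetTwo]
    congr 2
    ring

theorem sum_fin_add_sum_fin (n : ℕ) :
    ∑ k : Fin n, ((k : ℕ) : R) + ∑ k : Fin n, ((k : ℕ) : R) = n * (n - 1) := by
  induction n with
  | zero => simp
  | succ n ih =>
    simp only [Fin.sum_univ_castSucc, Fin.val_castSucc, Fin.val_last]
    push_cast
    linear_combination ih

theorem hankelDetTwo_sub_hankelDetOneOne (t ν : R)
    (hc : ∀ i : ℤ, c (i + 2) = t * c (i + 1) - (ν - i) * c i) (n : ℕ) (b : ℤ) :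
    hankelDetTwo c n b - hankelDetOneOne c n b =
      t * hankelDetOne c n b + n * (n - 1 - ν + b) * hankelDet c n b := by
  rw [← sum_hankelMinor_update_two, ← sum_hankelMinor_update_one]
  simp only [hankelMinor_update]
  set H : Fin n → Fin n → R := hankelRow c n ∘ consec n b with hH
  rw [← trace_mul_adjugate (fun i => hankelRow c n (consec n b i + 2)) H,
    ← trace_mul_adjugate (fun i => hankelRow c n (consec n b i + 1)) H]
  have hX : Matrix.of (fun i => hankelRow c n (consec n b i + 2)) =
      t • Matrix.of (fun i => hankelRow c n (consec n b i + 1)) +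
        Matrix.diagonal (fun k : Fin n => (b : R) - ν + (k : ℕ)) * Matrix.of H +
        Matrix.of H * Matrix.diagonal (fun l : Fin n => ((l : ℕ) : R)) := by
    ext k l
    simp only [Matrix.add_apply, Matrix.smul_apply, Matrix.diagonal_mul, Matrix.mul_diagonal,
      Matrix.of_apply, hH, Function.comp_apply, hankelRow, consec, smul_eq_mul]
    have := hc (b + k + l)
    rw [show b + (k : ℕ) + 2 + ((l : ℕ) : ℤ) = b + (k : ℕ) + (l : ℕ) + 2 by ring, this,
      show b + (k : ℕ) + 1 + ((l : ℕ) : ℤ) = b + (k : ℕ) + (l : ℕ) + 1 by ring]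
    push_cast
    ring
  have hdet : (Matrix.of H).det = hankelDet c n b := rfl
  rw [hX, add_mul, add_mul, Matrix.trace_add, Matrix.trace_add, Matrix.smul_mul,
    Matrix.trace_smul, mul_assoc, Matrix.mul_adjugate, Matrix.trace_mul_comm (Matrix.of H * _),
    ← mul_assoc, Matrix.adjugate_mul, hdet]
  simp only [Matrix.mul_smul, mul_one, Matrix.smul_mul, one_mul, Matrix.trace_smul,
    Matrix.trace_diagonal, smul_eq_mul, Finset.sum_add_distrib, Finset.sum_const,
    Finset.card_univ, Fintype.card_fin, nsmul_eq_mul]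
  linear_combination hankelDet c n b * sum_fin_add_sum_fin (R := R) n

theorem hankelDet_bilinear_succ (n : ℕ) (b : ℤ) :
    hankelDetOneOne c (n + 1) b * hankelDet c n b - hankelDetOne c (n + 1) b * hankelDetOne c n b
      + hankelDet c (n + 1) b * hankelDetTwo c n b = 0 := by
  rcases n with _ | m
  · simp [hankelDetOneOne, hankelDetOne, hankelDetTwo]
  have h := plucker_last c (consec m b) (b + m) (b + m + 1) (b + m + 2)
  simp only [hankelDet, hankelDetOneOne, hankelDetOne, hankelDetTwo, consec_succ]
  push_cast
  simp only [← add_assoc]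
  rw [show b + m + 1 + 1 = b + m + 2 by ring]
  linear_combination h

theorem hankelDet_bilinear_succ_shift (n : ℕ) (b : ℤ) :
    hankelDetOneOne c (n + 1) b * hankelDet c n (b + 1)
      - hankelDetOne c (n + 1) b * hankelDetOne c n (b + 1)
      + hankelDet c (n + 1) b * hankelDetTwo c n (b + 1) = 0 := by
  rcases n with _ | m
  · simp [hankelDetOneOne, hankelDetOne, hankelDetTwo]
  have h := plucker_zero c (consec m b) (b + m) (b + m + 1) (b + m + 2)
  simp only [consec_add_one] at h
  simp only [hankelDet, hankelDetOneOne, hankelDetOne, hankelDetTwo, consec_succ]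
  push_cast
  rw [show b + 1 + m = b + m + 1 by ring]
  simp only [← add_assoc]
  rw [show b + m + 1 + 1 = b + m + 2 by ring] at *
  rw [show b + m + 1 + 2 = b + m + 2 + 1 by ring] at *
  linear_combination h

theorem consec_succ_snoc_last (m : ℕ) (b x : ℤ) :
    hankelMinor c (Fin.snoc (consec (m + 1) b) x : Fin (m + 2) → ℤ) =
      (-1) ^ (m + 1) * hankelMinor c
        (Fin.snoc (Fin.snoc (consec m (b + 1)) x : Fin (m + 1) → ℤ) b : Fin (m + 2) → ℤ) := by
  rw [consec_succ', ← Fin.cons_snoc_eq_snoc_cons, hankelMinor_cons]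

theorem hankelMinor_consec_succ (m : ℕ) (b : ℤ) :
    hankelMinor c (consec (m + 1) b) =
      (-1) ^ m * hankelMinor c (Fin.snoc (consec m (b + 1)) b : Fin (m + 1) → ℤ) := by
  rw [consec_succ', hankelMinor_cons]

theorem hankelDet_bilinear_shift (n : ℕ) (b : ℤ) :
    hankelDetOneOne c n (b + 1) * hankelDet c n b
      - hankelDetOne c n (b + 1) * hankelDetOne c n b
      + hankelDet c n (b + 1) * hankelDetTwo c n b = 0 := by
  rcases n with _ | _ | m
  · simp [hankelDetOneOne, hankelDetOne, hankelDetTwo]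
  · simp [hankelDet, hankelDetOneOne, hankelDetOne, hankelDetTwo, hankelMinor, hankelRow,
      detRowAlternating_eq_det_of, consec, Fin.snoc]
    ring_nf
  have h := borderDet_plucker (hankelRow c (m + 2) ∘ consec m (b + 1)) (hankelRow c _ (b + m + 1))
    (hankelRow c _ (b + m + 2)) (hankelRow c _ (b + m + 3)) (hankelRow c _ b)
  simp only [← hankelMinor_snoc_snoc] at h
  simp only [hankelDet, hankelDetOneOne, hankelDetOne, hankelDetTwo]
  rw [consec_succ (m + 1) b]
  simp only [consec_succ_snoc_last c m b]
  simp only [consec_succ]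
  push_cast
  simp only [← add_assoc]
  rw [show b + 1 + m = b + m + 1 by ring, show b + m + 1 + 1 = b + m + 2 by ring,
    show b + m + 1 + 2 = b + m + 3 by ring, show b + m + 2 + 1 = b + m + 3 by ring]
  linear_combination (-1) ^ (m + 1) * h

theorem hankelDet_wronskian_shift (m : ℕ) (b : ℤ) :
    hankelDetOne c (m + 1) (b + 1) * hankelDet c (m + 1) b
      - hankelDet c (m + 1) (b + 1) * hankelDetOne c (m + 1) b
      = hankelDet c (m + 2) b * hankelDet c m (b + 1) := by
  have h := borderDet_plucker (hankelRow c (m + 2) ∘ consec m b) (hankelRow c _ (b + m))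
    (hankelRow c _ (b + m + 1)) (Pi.single 0 1) (Pi.single (Fin.last _) 1)
  simp only [← hankelMinor_snoc_snoc, borderDet_single_zero, borderDet_single_last,
    borderDet_single_zero_single_last, consec_add_one] at h
  have hs : ((-1 : R) ^ m) * (-1) ^ m = 1 := by simp [← mul_pow]
  simp only [hankelDet, hankelDetOne, consec_succ]
  push_cast
  rw [show b + 1 + m = b + m + 1 by ring]
  simp only [← add_assoc]
  rw [pow_succ] at h
  set X := hankelMinor c (Fin.snoc (consec m b) (b + m) : Fin (m + 1) → ℤ)
  set Y := hankelMinor c (Fin.snoc (consec m b) (b + m + 1) : Fin (m + 1) → ℤ)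
  set Z := hankelMinor c (Fin.snoc (consec m (b + 1)) (b + m + 1) : Fin (m + 1) → ℤ)
  set W := hankelMinor c (Fin.snoc (consec m (b + 1)) (b + m + 1 + 1) : Fin (m + 1) → ℤ)
  set A := hankelMinor c (Fin.snoc (Fin.snoc (consec m b) (b + m) : Fin (m + 1) → ℤ) (b + m + 1) :
    Fin (m + 2) → ℤ)
  set G := hankelMinor c (consec m (b + 1))
  linear_combination -(-1) ^ m * h + (A * G + Z * Y - W * X) * hs

theorem hankelDet_wronskian_succ (n : ℕ) (b : ℤ) :
    hankelDetOne c (n + 1) b * hankelDet c n (b + 1)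
      - hankelDet c (n + 1) b * hankelDetOne c n (b + 1)
      = hankelDet c n b * hankelDet c (n + 1) (b + 1) := by
  rcases n with _ | m
  · simp [hankelDet, hankelDetOne, hankelMinor, hankelRow, detRowAlternating_eq_det_of, consec,
      Fin.snoc]
  have h := plucker_last c (consec m (b + 1)) (b + m + 1) (b + m + 2) b
  have hs : ((-1 : R) ^ m) * (-1) ^ m = 1 := by simp [← mul_pow]
  simp only [hankelDet, hankelDetOne]
  rw [consec_succ (m + 1) b, consec_succ (m + 1) (b + 1), hankelMinor_consec_succ c m b]
  simp only [consec_succ_snoc_last c m b]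
  simp only [consec_succ]
  push_cast
  simp only [← add_assoc]
  rw [show b + 1 + m = b + m + 1 by ring, show b + m + 1 + 1 = b + m + 2 by ring]
  linear_combination (-1) ^ (m + 1) * h

theorem hankelDet_wronskian_succ_shift (n : ℕ) (b : ℤ) :
    hankelDetOne c (n + 1) b * hankelDet c n (b + 2)
      - hankelDet c (n + 1) b * hankelDetOne c n (b + 2)
      = hankelDet c n (b + 1) * hankelDet c (n + 1) (b + 1) := by
  rcases n with _ | m
  · simp [hankelDet, hankelDetOne, hankelMinor, hankelRow, detRowAlternating_eq_det_of, consec,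
      Fin.snoc]
  have h := plucker_zero c (consec m (b + 1)) (b + m + 1) (b + m + 2) b
  simp only [consec_add_one] at h
  simp only [hankelDet, hankelDetOne]
  rw [consec_succ (m + 1) b, consec_succ (m + 1) (b + 1),
    hankelMinor_consec_succ c m (b + 1)]
  simp only [consec_succ_snoc_last c m b]
  simp only [consec_succ]
  push_cast
  simp only [← add_assoc]
  rw [show b + 1 + 1 = b + 2 by ring] at *
  rw [show b + 1 + m = b + m + 1 by ring, show b + m + 1 + 1 = b + m + 2 by ring,
    show b + 2 + m = b + m + 2 by ring] at *
  linear_combination (-1) ^ (m + 1) * h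

end HankelMinor

section Derivative

variable {c : ℝ → ℤ → ℂ} {t : ℝ}

theorem hasDerivAt_hankelMinor (hc : ∀ i, HasDerivAt (fun s => c s i) (c t (i + 1)) t)
    {n : ℕ} (σ : Fin n → ℤ) :
    HasDerivAt (fun s => hankelMinor (c s) σ)
      (∑ i, hankelMinor (c t) (Function.update σ i (σ i + 1))) t := by
  have h := hasDerivAt_detRowAlternating (M := fun i j s => hankelRow (c s) n (σ i) j)
    (M' := fun i j => hankelRow (c t) n (σ i + 1) j) (t := t) fun i j => by
      simpa only [hankelRow, add_right_comm] using hc (σ i + (j : ℕ))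
  simp only [hankelMinor_update]
  exact h

theorem hasDerivAt_hankelDet (hc : ∀ i, HasDerivAt (fun s => c s i) (c t (i + 1)) t)
    (n : ℕ) (b : ℤ) :
    HasDerivAt (fun s => hankelDet (c s) n b) (hankelDetOne (c t) n b) t :=
  (hasDerivAt_hankelMinor hc _).congr_deriv (sum_hankelMinor_update_one _ n b)

theorem hasDerivAt_hankelDetOne (hc : ∀ i, HasDerivAt (fun s => c s i) (c t (i + 1)) t)
    (n : ℕ) (b : ℤ) :
    HasDerivAt (fun s => hankelDetOne (c s) n b)
      (hankelDetOneOne (c t) n b + hankelDetTwo (c t) n b) t := by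
  rcases n with _ | m
  · simpa [hankelDetOne, hankelDetOneOne, hankelDetTwo] using hasDerivAt_const t (0 : ℂ)
  · exact (hasDerivAt_hankelMinor hc _).congr_deriv (sum_hankelMinor_update_snoc _ m b _ rfl)

end Derivative

section Gauge

variable {ν : ℂ} {φ : ℤ → ℝ → ℂ}

/-- The sequence `i ↦ e^{s²/4} φ_{ν - i}(s)`. -/
noncomputable def gauged (φ : ℤ → ℝ → ℂ) (s : ℝ) (i : ℤ) : ℂ :=
  Complex.exp ((s : ℂ) ^ 2 / 4) * φ (-i) s

theorem hasDerivAt_gauged (hdiff : ∀ j, Differentiable ℝ (φ j))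
    (hdown : ∀ (j : ℤ) (t : ℝ), deriv (φ j) t = -((t : ℂ) / 2) * φ j t + φ (j - 1) t)
    (t : ℝ) (i : ℤ) : HasDerivAt (fun s => gauged φ s i) (gauged φ t (i + 1)) t := by
  have h1 : HasDerivAt (fun s : ℝ => Complex.exp ((s : ℂ) ^ 2 / 4))
      (Complex.exp ((t : ℂ) ^ 2 / 4) * ((2 * (t : ℂ)) / 4)) t := by
    have := ((Complex.ofRealCLM.hasDerivAt (x := t)).pow 2).div_const (4 : ℂ)
    simpa using this.cexp
  have h2 := (hdiff (-i) t).hasDerivAt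
  rw [hdown] at h2
  refine (h1.mul h2).congr_deriv ?_
  rw [gauged, show -(i + 1) = -i - 1 by ring]
  ring

theorem gauged_recurrence
    (hdown : ∀ (j : ℤ) (t : ℝ), deriv (φ j) t = -((t : ℂ) / 2) * φ j t + φ (j - 1) t)
    (hup : ∀ (j : ℤ) (t : ℝ),
      deriv (φ j) t = ((t : ℂ) / 2) * φ j t - (ν + j + 1) * φ (j + 1) t)
    (t : ℝ) (i : ℤ) :
    gauged φ t (i + 2) = t * gauged φ t (i + 1) - (ν - i) * gauged φ t i := by
  have h1 := hdown (-(i + 1)) t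
  have h2 := hup (-(i + 1)) t
  rw [show -(i + 1) - 1 = -(i + 2) by ring] at h1
  rw [show -(i + 1) + 1 = -i by ring] at h2
  push_cast at h2
  simp only [gauged]
  linear_combination Complex.exp ((t : ℂ) ^ 2 / 4) * (h2 - h1)

theorem iterate_deriv_gauged
    (hderiv : ∀ (t : ℝ) (i : ℤ), HasDerivAt (fun s => gauged φ s i) (gauged φ t (i + 1)) t)
    (j : ℤ) (k : ℕ) :
    deriv^[k] (fun s : ℝ => Complex.exp ((s : ℂ) ^ 2 / 4) * φ j s) =
      fun s => gauged φ s (-j + k) := by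
  induction k with
  | zero => simp [gauged]
  | succ k ih =>
    rw [Function.iterate_succ_apply', ih]
    funext s
    rw [(hderiv s _).deriv]
    push_cast
    rw [add_assoc]

end Gauge

/-- The bilinear relation `(D² - t D) x · y = (κ - μ) x y`, divided by `x y`. -/
theorem bilinear_normalized {t x x₁ A B y y₁ A' B' κ μ : ℂ} (hx : x ≠ 0) (hy : y ≠ 0)
    (h : A * y - x₁ * y₁ + x * B' = 0) (hκ : B - A = t * x₁ + κ * x)
    (hμ : B' - A' = t * y₁ + μ * y) :
    (A + B) / x - 2 * (x₁ / x) * (y₁ / y) + (A' + B') / y =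
      t * (x₁ / x - y₁ / y) + κ - μ := by
  field_simp
  linear_combination 2 * h + y * hκ - x * hμ

theorem sub_mul_self_div_sq {x x₁ x₂ : ℂ} (hx : x ≠ 0) :
    (x₂ * x - x₁ * x₁) / x ^ 2 = x₂ / x - (x₁ / x) ^ 2 := by
  field_simp

theorem hankelDet_log_derivative_recurrence {c : ℤ → ℂ} {t ν : ℂ}
    (hrec : ∀ i : ℤ, c (i + 2) = t * c (i + 1) - (ν - i) * c i) (n : ℕ)
    (ha : hankelDet c n 1 ≠ 0) (hb : hankelDet c n 0 ≠ 0) (hc : hankelDet c (n + 1) 0 ≠ 0) :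
    (ν + 1) * (hankelDet c n 1 * hankelDet c (n + 1) (-1)) /
        (hankelDet c n 0 * hankelDet c (n + 1) 0) =
      hankelDetOne c n 0 / hankelDet c n 0 - hankelDetOne c (n + 1) 0 / hankelDet c (n + 1) 0
        + t := by
  have hκ := hankelDetTwo_sub_hankelDetOneOne c t ν hrec
  have eab := bilinear_normalized ha hb (hankelDet_bilinear_shift c n 0) (hκ n 1) (hκ n 0)
  have eca := bilinear_normalized hc ha (hankelDet_bilinear_succ_shift c n 0)
    (hκ (n + 1) 0) (hκ n 1)
  have heb := hankelDet_bilinear_succ_shift c n (-1)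
  have hce := hankelDet_bilinear_shift c (n + 1) (-1)
  have hw := hankelDet_wronskian_succ_shift c n (-1)
  have κa := hκ n 1
  have κb := hκ n 0
  have κc := hκ (n + 1) 0
  have κe := hκ (n + 1) (-1)
  rw [show (-1 : ℤ) + 1 = 0 by norm_num] at heb hce hw
  rw [show (-1 : ℤ) + 2 = 1 by norm_num] at hw
  push_cast at eab eca κa κb κc κe
  generalize hankelDet c n 1 = a at *
  generalize hankelDetOne c n 1 = a₁ at *
  generalize hankelDetOneOne c n 1 = a₂ at *
  generalize hankelDetTwo c n 1 = a₃ at *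
  generalize hankelDet c n 0 = b at *
  generalize hankelDetOne c n 0 = b₁ at *
  generalize hankelDetOneOne c n 0 = b₂ at *
  generalize hankelDetTwo c n 0 = b₃ at *
  generalize hankelDet c (n + 1) 0 = d at *
  generalize hankelDetOne c (n + 1) 0 = d₁ at *
  generalize hankelDetOneOne c (n + 1) 0 = d₂ at *
  generalize hankelDetTwo c (n + 1) 0 = d₃ at *
  generalize hankelDet c (n + 1) (-1) = e at *
  generalize hankelDetOne c (n + 1) (-1) = e₁ at *
  generalize hankelDetOneOne c (n + 1) (-1) = e₂ at *
  generalize hankelDetTwo c (n + 1) (-1) = e₃ at *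
  have heb' : (e₂ + e₃) - 2 * e₁ * (b₁ / b) + e * ((b₂ + b₃) / b) =
      t * (e₁ - e * (b₁ / b)) + ((n + 1) * (n - ν - 1) - n * (n - 1 - ν)) * e := by
    field_simp
    linear_combination 2 * heb + b * κe - e * κb
  have hce' : (e₂ + e₃) - 2 * e₁ * (d₁ / d) + e * ((d₂ + d₃) / d) =
      t * (e * (d₁ / d) - e₁) + ((n + 1) * (n - ν) - (n + 1) * (n - ν - 1)) * e := by
    field_simp
    linear_combination 2 * hce + e * κc - d * κe
  have hw' : e₁ - e * (a₁ / a) = b * d / a := by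
    field_simp
    linear_combination hw
  have main : (b * d / a) * (b₁ / b - d₁ / d + t) = (ν + 1) * e := by
    rw [← hw']
    linear_combination (-1 / 2 : ℂ) * (heb' - hce') + (e / 2) * (eab - eca)
  rw [div_eq_iff (mul_ne_zero hb hc)]
  have := congrArg (a * ·) main
  simp only [← mul_assoc, mul_div_cancel₀ _ ha] at this
  linear_combination -this

/-- the functions
`f₀ = τ_{n+1}^{ν}τ_{n-1}^{ν-1}/(τ_n^{ν-1}τ_n^{ν})`,
`f₁ = τ_n^{ν}τ_{n+1}^{ν-1}/(τ_{n+1}^{ν}τ_n^{ν-1})`,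
`f₂ = (ν+1)τ_n^{ν-1}τ_{n+1}^{ν+1}/(τ_n^{ν}τ_{n+1}^{ν})`
give a solution of the symmetric form of P_IV with
`(α₀,α₁,α₂) = (-n, -ν+n, ν+1)`, together with the alternative logarithmic
derivative expressions. -/
theorem pIV_det_solution_symmetric
    (ν : ℂ) (hν : ν ∉ Set.range ((↑·) : ℤ → ℂ))
    (φ : ℤ → ℝ → ℂ)
    (hsmooth : ∀ j : ℤ, ContDiff ℝ (⊤ : ℕ∞) (φ j))
    (hdown : ∀ (j : ℤ) (t : ℝ), deriv (φ j) t = -((t : ℂ) / 2) * φ j t + φ (j - 1) t)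
    (hup : ∀ (j : ℤ) (t : ℝ),
      deriv (φ j) t = ((t : ℂ) / 2) * φ j t - (ν + j + 1) * φ (j + 1) t)
    (τ : ℤ → ℤ → ℝ → ℂ)
    (hτ : ∀ (j m : ℤ) (t : ℝ), τ j m t =
      if m < 0 then 0
      else Matrix.det (Matrix.of fun k l : Fin m.toNat =>
        deriv^[(k : ℕ) + (l : ℕ)] (fun s : ℝ => Complex.exp ((s : ℂ) ^ 2 / 4) * φ j s) t))
    (n : ℕ) (U : Set ℝ) (hU : IsOpen U)
    (hden1 : ∀ t ∈ U, τ (-1) n t ≠ 0)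
    (hden2 : ∀ t ∈ U, τ 0 n t ≠ 0)
    (hden3 : ∀ t ∈ U, τ 0 (n + 1) t ≠ 0)
    (f₀ f₁ f₂ : ℝ → ℂ)
    (hf₀ : ∀ t, f₀ t = τ 0 (n + 1) t * τ (-1) (n - 1) t / (τ (-1) n t * τ 0 n t))
    (hf₁ : ∀ t, f₁ t = τ 0 n t * τ (-1) (n + 1) t / (τ 0 (n + 1) t * τ (-1) n t))
    (hf₂ : ∀ t, f₂ t = (ν + 1) * (τ (-1) n t * τ 1 (n + 1) t) / (τ 0 n t * τ 0 (n + 1) t)) :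
    ∀ t ∈ U,
      (deriv f₀ t = f₀ t * (f₁ t - f₂ t) + (-(n : ℂ)) ∧
       deriv f₁ t = f₁ t * (f₂ t - f₀ t) + (-ν + n) ∧
       deriv f₂ t = f₂ t * (f₀ t - f₁ t) + (ν + 1) ∧
       f₀ t + f₁ t + f₂ t = (t : ℂ)) ∧
      (f₀ t = deriv (τ (-1) n) t / τ (-1) n t - deriv (τ 0 n) t / τ 0 n t ∧
       f₁ t = deriv (τ 0 (n + 1)) t / τ 0 (n + 1) t - deriv (τ (-1) n) t / τ (-1) n t ∧
       f₂ t = deriv (τ 0 n) t / τ 0 n t - deriv (τ 0 (n + 1)) t / τ 0 (n + 1) t + (t : ℂ)) := by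
  have hderiv := hasDerivAt_gauged (fun j => (hsmooth j).differentiable (by simp)) hdown
  have hrec := gauged_recurrence hdown hup
  have hτ' : ∀ (j : ℤ) (m : ℕ), τ j m = fun s => hankelDet (gauged φ s) m (-j) := by
    intro j m
    funext s
    rw [hτ, if_neg (by omega)]
    simp only [iterate_deriv_gauged hderiv, Int.toNat_natCast]
    change Matrix.det _ = Matrix.det _
    congr 1
    ext k l
    simp [hankelRow, consec, add_assoc]
  have ha : τ (-1) n = fun s => hankelDet (gauged φ s) n 1 := hτ' _ _
  have hb : τ 0 n = fun s => hankelDet (gauged φ s) n 0 := hτ' _ _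
  have hc : τ 0 (n + 1) = fun s => hankelDet (gauged φ s) (n + 1) 0 := hτ' 0 (n + 1)
  have he : τ 1 (n + 1) = fun s => hankelDet (gauged φ s) (n + 1) (-1) := hτ' 1 (n + 1)
  have hh : τ (-1) (n + 1) = fun s => hankelDet (gauged φ s) (n + 1) 1 := hτ' (-1) (n + 1)
  have hg : ∀ s, hankelDetOne (gauged φ s) n 1 * hankelDet (gauged φ s) n 0
      - hankelDet (gauged φ s) n 1 * hankelDetOne (gauged φ s) n 0
      = hankelDet (gauged φ s) (n + 1) 0 * τ (-1) (n - 1) s := by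
    intro s
    rcases n with _ | m
    · rw [hτ, if_pos (by simp)]
      simp [hankelDetOne]
    · rw [show ((m + 1 : ℕ) : ℤ) - 1 = (m : ℕ) by push_cast; ring, hτ']
      exact hankelDet_wronskian_shift (gauged φ s) m 0
  simp only [ha, hb, hc] at hden1 hden2 hden3
  have hf₀' : ∀ t ∈ U, f₀ t = hankelDetOne (gauged φ t) n 1 / hankelDet (gauged φ t) n 1
      - hankelDetOne (gauged φ t) n 0 / hankelDet (gauged φ t) n 0 := by
    intro t ht
    have h1 := hden1 t ht
    have h2 := hden2 t ht
    rw [hf₀, ha, hb, hc, ← hg]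
    field_simp
  have hf₁' : ∀ t ∈ U, f₁ t = hankelDetOne (gauged φ t) (n + 1) 0 / hankelDet (gauged φ t) (n + 1) 0
      - hankelDetOne (gauged φ t) n 1 / hankelDet (gauged φ t) n 1 := by
    intro t ht
    have h1 := hden1 t ht
    have h3 := hden3 t ht
    have h := hankelDet_wronskian_succ (gauged φ t) n 0
    rw [zero_add] at h
    rw [hf₁, ha, hb, hc, hh]
    simp only [← h]
    field_simp
  have hf₂' : ∀ t ∈ U, f₂ t = hankelDetOne (gauged φ t) n 0 / hankelDet (gauged φ t) n 0
      - hankelDetOne (gauged φ t) (n + 1) 0 / hankelDet (gauged φ t) (n + 1) 0 + t := by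
    intro t ht
    rw [hf₂, ha, hb, hc, he]
    exact hankelDet_log_derivative_recurrence (hrec t) n (hden1 t ht) (hden2 t ht) (hden3 t ht)
  intro t ht
  have h1 := hden1 t ht
  have h2 := hden2 t ht
  have h3 := hden3 t ht
  have da := hasDerivAt_hankelDet (hderiv t) n 1
  have db := hasDerivAt_hankelDet (hderiv t) n 0
  have dc := hasDerivAt_hankelDet (hderiv t) (n + 1) 0
  have la := (hasDerivAt_hankelDetOne (hderiv t) n 1).div da h1
  have lb := (hasDerivAt_hankelDetOne (hderiv t) n 0).div db h2
  have lc := (hasDerivAt_hankelDetOne (hderiv t) (n + 1) 0).div dc h3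
  have hκ := hankelDetTwo_sub_hankelDetOneOne (gauged φ t) (t : ℂ) ν (hrec t)
  have eab := bilinear_normalized h1 h2 (hankelDet_bilinear_shift (gauged φ t) n 0)
    (hκ n 1) (hκ n 0)
  have eca := bilinear_normalized h3 h1 (hankelDet_bilinear_succ_shift (gauged φ t) n 0)
    (hκ (n + 1) 0) (hκ n 1)
  have ecb := bilinear_normalized h3 h2 (hankelDet_bilinear_succ (gauged φ t) n 0)
    (hκ (n + 1) 0) (hκ n 0)
  have hU' := hU.mem_nhds ht
  have d₀ := ((la.sub lb).congr_of_eventuallyEq (Filter.eventuallyEq_of_mem hU' hf₀')).deriv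
  have d₁ := ((lc.sub la).congr_of_eventuallyEq (Filter.eventuallyEq_of_mem hU' hf₁')).deriv
  have d₂ := (((lb.sub lc).add Complex.ofRealCLM.hasDerivAt).congr_of_eventuallyEq
    (Filter.eventuallyEq_of_mem hU' hf₂')).deriv
  rw [sub_mul_self_div_sq h1, sub_mul_self_div_sq h2] at d₀
  rw [sub_mul_self_div_sq h3, sub_mul_self_div_sq h1] at d₁
  rw [sub_mul_self_div_sq h2, sub_mul_self_div_sq h3] at d₂
  simp only [Complex.ofRealCLM_apply, Complex.ofReal_one] at d₂
  push_cast at eab eca ecb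
  rw [ha, hb, hc, da.deriv, db.deriv, dc.deriv, d₀, d₁, d₂, hf₀' t ht, hf₁' t ht, hf₂' t ht]
  refine ⟨⟨?_, ?_, ?_, ?_⟩, rfl, rfl, rfl⟩
  · linear_combination eca - ecb
  · linear_combination ecb - eab
  · linear_combination eab - eca
  · ring
end

section
/- (Darboux's formula / Toda recurrence for Hankel determinants.) Let U ⊆ ℝ be open, let g : U → ℂ be smooth and nonvanishing, let φ : U → ℂ be smooth, and let δ denote the derivation δf = g·(df/dt). For n ≥ 0 define ρ_n = det( δ^{i+j}φ )_{0≤i,j≤n−1} (with ρ_0 = 1) and set ρ_{−1} = 0. Then for every n ≥ 0, ρ_{n+1}·ρ_{n−1} = (δ²ρ_n)·ρ_n − (δρ_n)² holds identically on U. -/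
open Matrix in
/-- The **Desnanot–Jacobi identity** when the common minor is invertible. -/
theorem Matrix.det_mul_det_submatrix_inl_of_isUnit {R m : Type*} [CommRing R] [Fintype m]
    [DecidableEq m] (M : Matrix (m ⊕ Fin 2) (m ⊕ Fin 2) R)
    (h : IsUnit (M.submatrix Sum.inl Sum.inl).det) :
    let e (i : Fin 2) : m ⊕ Fin 1 → m ⊕ Fin 2 := Sum.map id fun _ => i
    M.det * (M.submatrix Sum.inl Sum.inl).det =
      (M.submatrix (e 0) (e 0)).det * (M.submatrix (e 1) (e 1)).det -
        (M.submatrix (e 0) (e 1)).det * (M.submatrix (e 1) (e 0)).det := by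
  intro e
  let A := M.submatrix Sum.inl Sum.inl
  let : Invertible A := A.invertibleOfIsUnitDet h
  have hM : M.det = A.det * (M.toBlocks₂₂ - M.toBlocks₂₁ * ⅟A * M.toBlocks₁₂).det := by
    conv_lhs => rw [← fromBlocks_toBlocks M]
    exact det_fromBlocks₁₁ A _ _ _
  have he (i j : Fin 2) : (M.submatrix (e i) (e j)).det =
      A.det * (M.toBlocks₂₂ - M.toBlocks₂₁ * ⅟A * M.toBlocks₁₂) i j := by
    rw [← fromBlocks_toBlocks (M.submatrix (e i) (e j))]
    refine (det_fromBlocks₁₁ A _ _ _).trans ?_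
    rw [det_fin_one]
    rfl
  rw [hM, he, he, he, he, det_fin_two]
  ring

open Matrix Polynomial in
/-- The **Desnanot–Jacobi identity** (Dodgson condensation) over an integral domain. -/
theorem Matrix.det_mul_det_submatrix_inl {R m : Type*} [CommRing R] [IsDomain R] [Fintype m]
    [DecidableEq m] (M : Matrix (m ⊕ Fin 2) (m ⊕ Fin 2) R) :
    let e (i : Fin 2) : m ⊕ Fin 1 → m ⊕ Fin 2 := Sum.map id fun _ => i
    M.det * (M.submatrix Sum.inl Sum.inl).det =
      (M.submatrix (e 0) (e 0)).det * (M.submatrix (e 1) (e 1)).det -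
        (M.submatrix (e 0) (e 1)).det * (M.submatrix (e 1) (e 0)).det := by
  intro e
  -- Deform `M` to `X - M`, whose minor is a characteristic polynomial, hence nonzero.
  let N : Matrix (m ⊕ Fin 2) (m ⊕ Fin 2) R[X] := (-M).charmatrix
  have hN : N.submatrix Sum.inl Sum.inl = ((-M).submatrix Sum.inl Sum.inl).charmatrix := by
    ext i j : 1
    by_cases hij : i = j <;> simp [N, hij]
  let ι := algebraMap R[X] (FractionRing R[X])
  have key := det_mul_det_submatrix_inl_of_isUnit (N.map ι) (by
    rw [submatrix_map, hN, ← RingHom.mapMatrix_apply, ← RingHom.map_det, isUnit_iff_ne_zero]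
    exact (map_ne_zero_iff ι (IsFractionRing.injective _ _)).2
      (((-M).submatrix Sum.inl Sum.inl).charpoly_monic.ne_zero))
  simp only [submatrix_map] at key
  simp only [← RingHom.mapMatrix_apply, ← RingHom.map_det, ← map_mul, ← map_sub] at key
  have key_eval := congrArg (evalRingHom 0) (IsFractionRing.injective R[X] (FractionRing R[X]) key)
  have hM : N.map (evalRingHom 0) = M := by
    ext i j
    by_cases hij : i = j <;> simp [N, hij]
  simpa only [map_sub, map_mul, RingHom.map_det, RingHom.mapMatrix_apply, ← submatrix_map, hM]
    using key_eval

/-- The derivative of a determinant, row by row. -/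
theorem HasDerivAt.matrix_det {𝕜 𝔸 ι : Type*} [NontriviallyNormedField 𝕜] [NormedCommRing 𝔸]
    [NormedAlgebra 𝕜 𝔸] [Fintype ι] [DecidableEq ι] {M : 𝕜 → Matrix ι ι 𝔸} {M' : Matrix ι ι 𝔸}
    {t : 𝕜} (h : ∀ i j, HasDerivAt (fun s => M s i j) (M' i j) t) :
    HasDerivAt (fun s => (M s).det) (∑ i, ((M t).updateRow i (M' i)).det) t := by
  have hd : HasDerivAt (fun s => ∑ σ : Equiv.Perm ι,
        ((Equiv.Perm.sign σ : ℤ) : 𝔸) * ∏ i, (M s).transpose (σ i) i)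
      (∑ σ : Equiv.Perm ι, ((Equiv.Perm.sign σ : ℤ) : 𝔸) *
        ∑ i, (∏ j ∈ Finset.univ.erase i, M t j (σ j)) • M' i (σ i)) t :=
    HasDerivAt.fun_sum fun σ _ =>
      (HasDerivAt.fun_finsetProd fun i _ => h i (σ i)).const_mul _
  simp only [← Matrix.det_apply', Matrix.det_transpose] at hd
  convert hd using 1
  simp_rw [Finset.mul_sum]
  rw [Finset.sum_comm]
  refine Finset.sum_congr rfl fun i _ => ?_
  rw [← Matrix.det_transpose, Matrix.det_apply']
  refine Finset.sum_congr rfl fun σ _ => ?_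
  rw [← Finset.prod_erase_mul _ _ (Finset.mem_univ i), smul_eq_mul]
  congr 2
  · refine Finset.prod_congr rfl fun j hj => ?_
    simp [Matrix.updateRow_ne (Finset.ne_of_mem_erase hj)]
  · simp

/-- If `g · aₖ' = aₖ₊₁`, then differentiating the minor of the Hankel matrix of `a` on the rows
`0, …, k - 1, k` only shifts its last row. -/
theorem mul_deriv_det_hankel_minor {a : ℕ → ℝ → ℂ} {g : ℝ → ℂ} {t : ℝ} {k : ℕ}
    (ha : ∀ m, DifferentiableAt ℝ (a m) t) (hs : ∀ m, g t * deriv (a m) t = a (m + 1) t)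
    (c : Fin k ⊕ Fin 1 → ℕ) :
    g t * deriv (fun s => (Matrix.of fun i j =>
        a (Sum.elim (fun i : Fin k => (i : ℕ)) (fun _ : Fin 1 => k) i + c j) s).det) t =
      (Matrix.of fun i j =>
        a (Sum.elim (fun i : Fin k => (i : ℕ)) (fun _ : Fin 1 => k + 1) i + c j) t).det := by
  set r : Fin k ⊕ Fin 1 → ℕ := Sum.elim (fun i => (i : ℕ)) (fun _ => k) with hr
  rw [(HasDerivAt.matrix_det (M := fun s => .of fun i j => a (r i + c j) s)
    (M' := .of fun i j => deriv (a (r i + c j)) t)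
    fun i j => (ha (r i + c j)).hasDerivAt).deriv, Finset.mul_sum]
  simp_rw [← Matrix.det_updateRow_smul]
  have hrow (i) : g t • (Matrix.of fun i j => deriv (a (r i + c j)) t) i =
      fun j => a (r i + 1 + c j) t := by
    ext j
    simpa [add_right_comm] using hs (r i + c j)
  simp_rw [hrow]
  rw [Fintype.sum_sum_type, Finset.sum_eq_zero, zero_add, Fin.sum_univ_one]
  · congr 1
    ext i j
    rcases i with i | i
    · rw [Matrix.updateRow_ne (by simp)]
      simp [hr]
    · obtain rfl := Subsingleton.elim i 0
      simp [hr]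
  · intro i _
    obtain ⟨l, hl, hli⟩ : ∃ l, r l = r (.inl i) + 1 ∧ l ≠ .inl i := by
      by_cases hi : (i : ℕ) + 1 < k
      · exact ⟨.inl ⟨i + 1, hi⟩, rfl, by simp [Fin.ext_iff]⟩
      · exact ⟨.inr 0, by simp only [hr, Sum.elim_inl, Sum.elim_inr]; omega, by simp⟩
    refine Matrix.det_zero_of_row_eq hli ?_
    rw [Matrix.updateRow_self, Matrix.updateRow_ne hli]
    ext j
    simp [hl]

/-- Darboux's formula / Toda recurrence for Hankel determinants:
for the derivation `δf = g·f'` with `g` smooth and nonvanishing on an open set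
`U`, the Hankel determinants `ρ_n = det(δ^{i+j}φ)` (with `ρ₀ = 1`, `ρ₋₁ = 0`)
satisfy `ρ_{n+1}ρ_{n-1} = (δ²ρ_n)ρ_n - (δρ_n)²` on `U`. -/
theorem darboux_toda_hankel
    (U : Set ℝ) (hU : IsOpen U) (g φ : ℝ → ℂ)
    (hg : ContDiffOn ℝ (⊤ : ℕ∞) g U) (hφ : ContDiffOn ℝ (⊤ : ℕ∞) φ U)
    (hg0 : ∀ t ∈ U, g t ≠ 0)
    (δ : (ℝ → ℂ) → ℝ → ℂ)
    (hδ : ∀ f : ℝ → ℂ, ∀ t : ℝ, δ f t = g t * deriv f t)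
    (ρ : ℤ → ℝ → ℂ)
    (hρ : ∀ m : ℤ, ∀ t : ℝ, ρ m t =
      if m < 0 then 0
      else Matrix.det (Matrix.of fun i j : Fin m.toNat =>
        δ^[(i : ℕ) + (j : ℕ)] φ t)) :
    ∀ n : ℕ, ∀ t ∈ U,
      ρ (n + 1) t * ρ (n - 1) t =
        δ (δ (ρ n)) t * ρ n t - (δ (ρ n) t) ^ 2 := by
  intro n t ht
  have hρn (m : ℕ) (s : ℝ) :
      ρ m s = (Matrix.of fun i j : Fin m => δ^[(i : ℕ) + (j : ℕ)] φ s).det := by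
    rw [hρ, if_neg (by omega)]
    rfl
  rcases n with _ | k
  · have h0 : ρ ((0 : ℕ) : ℤ) = fun _ => 1 := by
      ext s
      rw [hρn, Matrix.det_isEmpty]
    have h1 : δ (fun _ => 1) = fun _ => 0 := by
      ext s
      simp [hδ]
    rw [h0, h1, hδ, hρ (_ - 1), if_pos (by norm_num)]
    simp
  set a : ℕ → ℝ → ℂ := fun m => δ^[m] φ with ha
  have hsmooth (m : ℕ) : ContDiffOn ℝ (⊤ : ℕ∞) (a m) U := by
    induction m with
    | zero => exact hφ
    | succ m ih =>
      have : a (m + 1) = fun s => g s * deriv (a m) s := by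
        ext s
        rw [ha]
        simp only [Function.iterate_succ_apply', hδ]
      rw [this]
      exact hg.mul (ih.deriv_of_isOpen hU (by simp))
  have hdiff (s : ℝ) (hs : s ∈ U) (m : ℕ) : DifferentiableAt ℝ (a m) s :=
    ((hsmooth m).contDiffAt (hU.mem_nhds hs)).differentiableAt (by simp)
  have hshift (s : ℝ) (m : ℕ) : g s * deriv (a m) s = a (m + 1) s := by
    rw [ha]
    simp only [Function.iterate_succ_apply', hδ]
  -- `H p q` is the minor on rows `0, …, k - 1, k + p` and columns `0, …, k - 1, k + q`.
  let r (p : ℕ) : Fin k ⊕ Fin 1 → ℕ := Sum.elim (fun i => (i : ℕ)) (fun _ => k + p)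
  let H (p q : ℕ) (s : ℝ) : ℂ := (Matrix.of fun i j => a (r p i + r q j) s).det
  have hH (q : ℕ) (s : ℝ) (hs : s ∈ U) : δ (H 0 q) s = H 1 q s :=
    (hδ _ _).trans (mul_deriv_det_hankel_minor (hdiff s hs) (hshift s) (r q))
  have hsymm (p q : ℕ) : H p q = H q p := by
    ext s
    simp only [H]
    rw [← Matrix.det_transpose]
    congr 1
    ext i j
    simp [add_comm]
  have hk : ρ ((k + 1 : ℕ) : ℤ) = H 0 0 := by
    ext s
    rw [hρn, ← Matrix.det_submatrix_equiv_self (finSumFinEquiv (m := k) (n := 1))]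
    congr 1
    ext i j
    rcases i with i | i <;> rcases j with j | j <;> simp [r, ha]
  have hδ2 : δ (δ (H 0 0)) t = H 1 1 t := by
    have : δ (H 0 0) =ᶠ[nhds t] H 0 1 := by
      filter_upwards [hU.mem_nhds ht] with s hs
      rw [hH 0 s hs, hsymm]
    rw [hδ, this.deriv_eq, ← hδ, hH 1 t ht]
  let v : Fin k ⊕ Fin 2 → ℕ := Sum.elim (fun i => (i : ℕ)) (fun i => k + i)
  let M : Matrix (Fin k ⊕ Fin 2) (Fin k ⊕ Fin 2) ℂ := .of fun i j => a (v i + v j) t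
  have hM : ρ ((k + 1 : ℕ) + 1) t = M.det := by
    rw [← Nat.cast_succ, hρn,
      ← Matrix.det_submatrix_equiv_self (finSumFinEquiv (m := k) (n := 2))]
    congr 1
    ext i j
    rcases i with i | i <;> rcases j with j | j <;> simp [M, v, ha]
  have hA : ρ ((k + 1 : ℕ) - 1) t = (M.submatrix Sum.inl Sum.inl).det := by
    rw [Nat.cast_succ, add_sub_cancel_right, hρn]
    rfl
  have hminor (p q : Fin 2) :
      (M.submatrix (Sum.map id fun _ : Fin 1 => p) (Sum.map id fun _ : Fin 1 => q)).det =
        H p q t := by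
    simp only [H]
    congr 1
    ext i j
    rcases i with i | i <;> rcases j with j | j <;> rfl
  rw [hM, hA, hk, hδ2, hH 0 t ht, M.det_mul_det_submatrix_inl]
  simp only [hminor, Fin.val_zero, Fin.val_one, hsymm 0 1]
  ring
end

section
/- Let a, b, c ∈ ℂ with a ≠ 0 and let φ be a smooth nonvanishing solution, on an open subinterval of (0,1), of the hypergeometric differential equation t(t−1)·φ''(t) + [(a+b+3)t − (c+1)]·φ'(t) + (a+1)(b+1)·φ(t) = 0. Define q by a·q(t) = −t(t−1)·φ'(t)/φ(t) − (b+1)t + c. Then q satisfies the Riccati equation q' = α₁ q² + [(α₃+α₄)t + (α₀+α₄−1)]q − α₄ t with ' = t(t−1) d/dt and (α₀, α₁, α₃, α₄) = (−b, a, c−a, b−c+1). -/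
/-- for a nonvanishing solution of the hypergeometric equation
`t(t-1)φ'' + [(a+b+3)t - (c+1)]φ' + (a+1)(b+1)φ = 0` on an open subinterval of
`(0,1)`, the function `q` defined by `a q = -t(t-1)φ'/φ - (b+1)t + c` satisfies
the Riccati equation `q' = α₁q² + [(α₃+α₄)t + (α₀+α₄-1)]q - α₄t`, where
`' = t(t-1) d/dt` and `(α₀,α₁,α₃,α₄) = (-b, a, c-a, b-c+1)`. -/
theorem gauss_riccati
    (a b c : ℂ) (ha : a ≠ 0)
    (U : Set ℝ) (hU : IsOpen U) (hU01 : U ⊆ Set.Ioo 0 1)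
    (φ : ℝ → ℂ)
    (hφ : ContDiffOn ℝ (⊤ : ℕ∞) φ U)
    (hφ0 : ∀ t ∈ U, φ t ≠ 0)
    (hHG : ∀ t ∈ U,
      (t : ℂ) * ((t : ℂ) - 1) * deriv (deriv φ) t
        + ((a + b + 3) * (t : ℂ) - (c + 1)) * deriv φ t
        + (a + 1) * (b + 1) * φ t = 0)
    (q : ℝ → ℂ)
    (hq : ∀ t : ℝ, a * q t = -((t : ℂ) * ((t : ℂ) - 1)) * deriv φ t / φ t
      - (b + 1) * (t : ℂ) + c) :
    ∀ t ∈ U,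
      (t : ℂ) * ((t : ℂ) - 1) * deriv q t =
        a * (q t) ^ 2
          + (((c - a) + (b - c + 1)) * (t : ℂ) + ((-b) + (b - c + 1) - 1)) * q t
          - (b - c + 1) * (t : ℂ) := by
  intro t ht
  have hUt : U ∈ nhds t := hU.mem_nhds ht
  have hφ1 : HasDerivAt φ (deriv φ t) t :=
    ((hφ.contDiffAt hUt).differentiableAt (by simp)).hasDerivAt
  have hφ' : ContDiffOn ℝ 1 (deriv φ) U :=
    hφ.deriv_of_isOpen hU (WithTop.coe_le_coe.2 le_top)
  have hφ2 : HasDerivAt (deriv φ) (deriv (deriv φ) t) t :=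
    ((hφ'.contDiffAt hUt).differentiableAt (by simp)).hasDerivAt
  have hid : HasDerivAt (fun s : ℝ => (s : ℂ)) 1 t := (hasDerivAt_id t).ofReal_comp
  have hne : φ t ≠ 0 := hφ0 t ht
  have hq_eq : q = fun s : ℝ => (-((s : ℂ) * ((s : ℂ) - 1)) * deriv φ s / φ s
      - (b + 1) * (s : ℂ) + c) / a := by
    funext s
    rw [← hq s, mul_div_cancel_left₀ _ ha]
  have hq_deriv := ((((((hid.mul (hid.sub_const 1)).neg.mul hφ2).div hφ1 hne).sub
    (hid.const_mul (b + 1))).add_const c).div_const a).deriv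
  have hderiv : deriv q t = _ := (congrArg (fun f => deriv f t) hq_eq).trans hq_deriv
  have hqt : q t = _ := congrFun hq_eq t
  rw [hderiv, hqt]
  simp only [Pi.mul_apply, Pi.neg_apply]
  field_simp
  linear_combination (-(t : ℂ) * ((t : ℂ) - 1) * φ t) * hHG t ht
end
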